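/- (Bipartite Guth–Katz intersection bound) There is an absolute constant C such that the following holds. Let L and L' be two finite sets of lines in ℝ³ with |L'| ≤ |L|, and let s ≤ |L| be a parameter such that for every affine plane and for every zero set of a nonzero real polynomial in three variables of total degree at most 2, at most s lines of L are contained in it. Let P be the set of all points x ∈ ℝ³ such that there exist distinct lines l ∈ L and l' ∈ L' with x ∈ l and x ∈ l'. Then |P| ≤ C·(|L|·√|L'| + s·|L'|). -/

import Mathlib

open scoped Classical

/-- A line in `ℝ³`: a one-dimensional affine subspace, as a set of points. -/
def IsLine (l : Set (Fin 3 → ℝ)) : Prop :=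
  ∃ p v : Fin 3 → ℝ, v ≠ 0 ∧ l = {x | ∃ t : ℝ, x = p + t • v}

/-- An affine plane in `ℝ³`: the solution set of a nontrivial linear equation. -/
def IsPlane (π : Set (Fin 3 → ℝ)) : Prop :=
  ∃ (f : Fin 3 → ℝ) (c : ℝ), f ≠ 0 ∧ π = {x | ∑ i, f i * x i = c}

namespace LineIncidence

open MvPolynomial

/-- Points of `ℝ³`. -/
abbrev Pt := Fin 3 → ℝ

/-- Real polynomials in three variables. -/
abbrev Poly := MvPolynomial (Fin 3) ℝ

/-- The line through `p` with direction `v`. -/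
def line (p v : Pt) : Set Pt := {x | ∃ t : ℝ, x = p + t • v}

/-- The real zero set of a polynomial. -/
def zeroSet (f : Poly) : Set Pt := {x | eval x f = 0}

lemma mem_zeroSet {f : Poly} {x : Pt} : x ∈ zeroSet f ↔ eval x f = 0 := Iff.rfl

lemma mem_line (p v : Pt) (t : ℝ) : p + t • v ∈ line p v := ⟨t, rfl⟩

lemma isLine_line (p : Pt) {v : Pt} (hv : v ≠ 0) : IsLine (line p v) := ⟨p, v, hv, rfl⟩

lemma line_eq_of_mem {p v x : Pt} (hx : x ∈ line p v) : line p v = line x v := by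
  obtain ⟨s, rfl⟩ := hx
  ext y
  constructor
  · rintro ⟨t, rfl⟩
    exact ⟨t - s, by module⟩
  · rintro ⟨t, rfl⟩
    exact ⟨s + t, by module⟩

lemma line_smul (p v : Pt) {c : ℝ} (hc : c ≠ 0) : line p (c • v) = line p v := by
  ext y
  constructor
  · rintro ⟨t, rfl⟩
    exact ⟨t * c, by module⟩
  · rintro ⟨t, rfl⟩
    exact ⟨t / c, by rw [smul_smul, div_mul_cancel₀ _ hc]⟩

lemma _root_.IsLine.exists_eq_line {l : Set Pt} (hl : IsLine l) {x : Pt} (hx : x ∈ l) :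
    ∃ v : Pt, v ≠ 0 ∧ l = line x v := by
  obtain ⟨p, v, hv, rfl⟩ := hl
  exact ⟨v, hv, line_eq_of_mem hx⟩

lemma _root_.IsLine.eq_line_sub {l : Set Pt} (hl : IsLine l) {x y : Pt} (hx : x ∈ l) (hy : y ∈ l)
    (hxy : x ≠ y) : l = line x (y - x) := by
  obtain ⟨v, hv, rfl⟩ := hl.exists_eq_line hx
  obtain ⟨t, rfl⟩ := hy
  have ht : t ≠ 0 := by
    rintro rfl
    simp at hxy
  rw [add_sub_cancel_left, line_smul _ _ ht]

lemma _root_.IsLine.eq_of_two_mem {l m : Set Pt} (hl : IsLine l) (hm : IsLine m) {x y : Pt}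
    (hxy : x ≠ y) (hxl : x ∈ l) (hyl : y ∈ l) (hxm : x ∈ m) (hym : y ∈ m) : l = m := by
  rw [hl.eq_line_sub hxl hyl hxy, hm.eq_line_sub hxm hym hxy]

/-- The restriction of a polynomial to a parametrised line. -/
noncomputable def restr (p v : Pt) : Poly →ₐ[ℝ] Polynomial ℝ :=
  aeval fun i => Polynomial.C (p i) + Polynomial.C (v i) * Polynomial.X

lemma eval_restr (p v : Pt) (f : Poly) (t : ℝ) :
    (restr p v f).eval t = eval (p + t • v) f := by
  have h : (Polynomial.aeval t).comp (restr p v) = aeval (p + t • v) := by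
    ext i
    simp only [AlgHom.comp_apply, restr, aeval_X]
    simp
    ring
  have := congrArg (fun φ => φ f) h
  simpa [MvPolynomial.aeval_eq_eval, Polynomial.coe_aeval_eq_eval] using this

lemma natDegree_restr_le (p v : Pt) (f : Poly) : (restr p v f).natDegree ≤ f.totalDegree := by
  have h := aeval_natDegree_le (m := f.totalDegree) (n := 1) f le_rfl
    (fun i => Polynomial.C (p i) + Polynomial.C (v i) * Polynomial.X) (fun i => by
      refine (Polynomial.natDegree_add_le _ _).trans ?_
      simpa using (Polynomial.natDegree_C_mul_le (v i) Polynomial.X).trans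
        Polynomial.natDegree_X_le)
  simpa [restr] using h

lemma restr_eq_zero_iff (p v : Pt) (f : Poly) : restr p v f = 0 ↔ line p v ⊆ zeroSet f := by
  constructor
  · rintro h _ ⟨t, rfl⟩
    rw [mem_zeroSet, ← eval_restr, h, Polynomial.eval_zero]
  · intro h
    refine Polynomial.funext fun t => ?_
    rw [eval_restr, Polynomial.eval_zero]
    exact h (mem_line p v t)

lemma finite_inter_zeroSet {l : Set Pt} (hl : IsLine l) {f : Poly} (h : ¬ l ⊆ zeroSet f) :
    (l ∩ zeroSet f).Finite ∧ (l ∩ zeroSet f).ncard ≤ f.totalDegree := by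
  obtain ⟨p, v, hv, rfl⟩ := hl
  change ¬ line p v ⊆ zeroSet f at h
  change (line p v ∩ zeroSet f).Finite ∧ (line p v ∩ zeroSet f).ncard ≤ f.totalDegree
  rw [← restr_eq_zero_iff] at h
  have hsub : line p v ∩ zeroSet f ⊆
      ((restr p v f).roots.toFinset.image fun t : ℝ => p + t • v : Finset Pt) := by
    rintro _ ⟨⟨t, rfl⟩, ht⟩
    rw [Finset.coe_image]
    refine ⟨t, ?_, rfl⟩
    simpa [h, eval_restr, mem_zeroSet] using ht
  refine ⟨(Finset.finite_toSet _).subset hsub, ?_⟩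
  refine (Set.ncard_le_ncard hsub (Finset.finite_toSet _)).trans ?_
  rw [Set.ncard_coe_finset]
  exact Finset.card_image_le.trans ((Multiset.toFinset_card_le _).trans
    ((Polynomial.card_roots' _).trans (natDegree_restr_le p v f)))

lemma subset_zeroSet_of_card {l : Set Pt} (hl : IsLine l) {f : Poly} (S : Finset Pt)
    (hS : ∀ x ∈ S, x ∈ l ∧ eval x f = 0) (hcard : f.totalDegree < S.card) : l ⊆ zeroSet f := by
  by_contra h
  obtain ⟨hfin, hle⟩ := finite_inter_zeroSet hl h
  have : (S : Set Pt) ⊆ l ∩ zeroSet f := fun x hx => hS x hx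
  have := Set.ncard_le_ncard this hfin
  rw [Set.ncard_coe_finset] at this
  omega

lemma subset_zeroSet_mul_iff {l : Set Pt} (hl : IsLine l) (f g : Poly) :
    l ⊆ zeroSet (f * g) ↔ l ⊆ zeroSet f ∨ l ⊆ zeroSet g := by
  obtain ⟨p, v, hv, rfl⟩ := hl
  change line p v ⊆ _ ↔ line p v ⊆ _ ∨ line p v ⊆ _
  simp only [← restr_eq_zero_iff, map_mul, mul_eq_zero]

lemma _root_.IsLine.infinite {l : Set Pt} (hl : IsLine l) : l.Infinite := by
  obtain ⟨p, v, hv, rfl⟩ := hl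
  refine Set.infinite_of_injective_forall_mem (f := fun t : ℝ => p + t • v) ?_ (fun t => ⟨t, rfl⟩)
  intro a b hab
  have : a • v = b • v := by simpa using hab
  exact smul_left_injective ℝ hv this

/-- The space of polynomials of total degree at most `m`. -/
noncomputable abbrev polysLE (m : ℕ) : Submodule ℝ Poly := restrictTotalDegree (Fin 3) ℝ m

lemma mem_polysLE {m : ℕ} {f : Poly} : f ∈ polysLE m ↔ f.totalDegree ≤ m :=
  mem_restrictTotalDegree _ _ _

lemma six_mul_finrank_polysLE (m : ℕ) :
    6 * Module.finrank ℝ (polysLE m) = (m + 1) * (m + 2) * (m + 3) := by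
  set T : Finset (Fin 3 →₀ ℕ) :=
    (Finset.range (m + 1)).biUnion fun k => Finset.finsuppAntidiag Finset.univ k with hT
  have hset : {n : Fin 3 →₀ ℕ | (n.sum fun _ e => e) ≤ m} = (T : Set (Fin 3 →₀ ℕ)) := by
    ext n
    have hn : (n.sum fun _ e => e) = Finset.univ.sum n := Finsupp.sum_fintype n _ fun _ => rfl
    simp [hT, hn]
  have hrank : Module.finrank ℝ (polysLE m) = T.card := by
    have h := Module.finrank_eq_nat_card_basis
      (basisRestrictSupport ℝ {n : Fin 3 →₀ ℕ | (n.sum fun _ e => e) ≤ m})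
    refine h.trans ?_
    rw [hset]
    simp
  have hcard : T.card = ∑ k ∈ Finset.range (m + 1), (k + 2).choose 2 := by
    rw [hT, Finset.card_biUnion]
    · refine Finset.sum_congr rfl fun k _ => ?_
      rw [Finset.card_finsuppAntidiag_nat_eq_choose, Finset.card_univ, Fintype.card_fin,
        show 3 + k - 1 = k + 2 by omega, Nat.choose_symm_add]
    · intro a _ b _ hab
      rw [Function.onFun, Finset.disjoint_left]
      intro x hx hx'
      rw [Finset.mem_finsuppAntidiag] at hx hx'
      exact hab (hx.1.symm.trans hx'.1)
  rw [hrank, hcard]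
  clear hrank hcard hset hT T
  induction m with
  | zero => rfl
  | succ m ih =>
    rw [Finset.sum_range_succ, mul_add, ih]
    have h := Nat.choose_two_right (m + 1 + 2)
    have h2 : 2 * (m + 1 + 2).choose 2 = (m + 3) * (m + 2) := by
      rw [h, Nat.mul_div_cancel' (Nat.even_mul_pred_self _).two_dvd]
      rfl
    linarith

/-- Polynomials of degree at most `m` vanishing on all lines of `S`. -/
noncomputable def vanishing (S : Finset (Set Pt)) (m : ℕ) : Submodule ℝ Poly where
  carrier := {g | g.totalDegree ≤ m ∧ ∀ l ∈ S, l ⊆ zeroSet g}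
  add_mem' := by
    rintro a b ⟨ha, ha'⟩ ⟨hb, hb'⟩
    refine ⟨(totalDegree_add a b).trans (max_le ha hb), fun l hl x hx => ?_⟩
    have h1 := ha' l hl hx
    have h2 := hb' l hl hx
    rw [mem_zeroSet] at *
    rw [map_add, h1, h2, add_zero]
  zero_mem' := ⟨by simp, fun l _ x _ => by simp [mem_zeroSet]⟩
  smul_mem' := by
    rintro c a ⟨ha, ha'⟩
    refine ⟨(totalDegree_smul_le c a).trans ha, fun l hl x hx => ?_⟩
    have h1 := ha' l hl hx
    rw [mem_zeroSet] at *
    rw [smul_eval, h1, mul_zero]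

lemma mem_vanishing {S : Finset (Set Pt)} {m : ℕ} {g : Poly} :
    g ∈ vanishing S m ↔ g.totalDegree ≤ m ∧ ∀ l ∈ S, l ⊆ zeroSet g := Iff.rfl

lemma vanishing_le (S : Finset (Set Pt)) (m : ℕ) : vanishing S m ≤ polysLE m :=
  fun _ hg => mem_polysLE.2 hg.1

instance (S : Finset (Set Pt)) (m : ℕ) : FiniteDimensional ℝ (vanishing S m) :=
  Submodule.finiteDimensional_of_le (vanishing_le S m)

lemma finrank_vanishing_empty (m : ℕ) :
    Module.finrank ℝ (vanishing ∅ m) = Module.finrank ℝ (polysLE m) := by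
  have : vanishing ∅ m = polysLE m := by
    ext g
    simp [mem_vanishing, mem_polysLE]
  rw [this]

/-- Restriction to a line has kernel the polynomials which also vanish on that line. -/
lemma finrank_vanishing_insert (S : Finset (Set Pt)) (m : ℕ) (p v : Pt) :
    Module.finrank ℝ ((vanishing S m).map (restr p v).toLinearMap) +
      Module.finrank ℝ (vanishing (insert (line p v) S) m) =
      Module.finrank ℝ (vanishing S m) := by
  have h := ((restr p v).toLinearMap.domRestrict (vanishing S m)).finrank_range_add_finrank_ker
  rw [LinearMap.range_domRestrict] at h
  have hker : (LinearMap.ker ((restr p v).toLinearMap.domRestrict (vanishing S m))).map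
      (vanishing S m).subtype = vanishing (insert (line p v) S) m := by
    ext g
    simp only [mem_vanishing, Finset.mem_insert, forall_eq_or_imp, Submodule.mem_map,
      LinearMap.mem_ker, LinearMap.domRestrict_apply, AlgHom.toLinearMap_apply,
      Submodule.subtype_apply, Subtype.exists, exists_and_left, exists_prop,
      exists_eq_right_right, restr_eq_zero_iff]
    tauto
  rw [← h, ← hker, LinearEquiv.finrank_eq (Submodule.equivMapOfInjective (vanishing S m).subtype
    (Submodule.subtype_injective _)
    (LinearMap.ker ((restr p v).toLinearMap.domRestrict (vanishing S m))))]

lemma finrank_map_restr_le (S : Finset (Set Pt)) (m : ℕ) (p v : Pt) :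
    Module.finrank ℝ ((vanishing S m).map (restr p v).toLinearMap) ≤ m + 1 := by
  have hle : (vanishing S m).map (restr p v).toLinearMap ≤ Polynomial.degreeLT ℝ (m + 1) := by
    rintro _ ⟨g, hg, rfl⟩
    rw [Polynomial.mem_degreeLT]
    refine Polynomial.degree_lt_iff_coeff_zero _ _ |>.2 fun k hk => ?_
    refine Polynomial.coeff_eq_zero_of_natDegree_lt ?_
    have := (natDegree_restr_le p v g).trans hg.1
    change (restr p v g).natDegree < k
    omega
  have : FiniteDimensional ℝ (Polynomial.degreeLT ℝ (m + 1)) :=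
    LinearEquiv.finiteDimensional (Polynomial.degreeLTEquiv ℝ (m + 1)).symm
  refine (Submodule.finrank_mono hle).trans ?_
  rw [(Polynomial.degreeLTEquiv ℝ (m + 1)).finrank_eq]
  simp

lemma finrank_polysLE_le (S : Finset (Set Pt)) (hS : ∀ l ∈ S, IsLine l) (m : ℕ) :
    Module.finrank ℝ (polysLE m) ≤ Module.finrank ℝ (vanishing S m) + S.card * (m + 1) := by
  induction S using Finset.induction_on with
  | empty => simp [finrank_vanishing_empty]
  | insert l S hl ih =>
    have ih := ih fun l hl => hS l (Finset.mem_insert_of_mem hl)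
    obtain ⟨p, v, hv, rfl⟩ := hS l (Finset.mem_insert_self _ _)
    have h1 := finrank_vanishing_insert S m p v
    have h2 := finrank_map_restr_le S m p v
    rw [Finset.card_insert_of_notMem hl]
    change _ ≤ Module.finrank ℝ (vanishing (insert (line p v) S) m) + _
    nlinarith

/-- Parameter counting: few lines lie on a surface of small degree. -/
lemma exists_vanishing (S : Finset (Set Pt)) (hS : ∀ l ∈ S, IsLine l) (m : ℕ)
    (h : 6 * S.card < (m + 2) * (m + 3)) :
    ∃ g : Poly, g ≠ 0 ∧ g.totalDegree ≤ m ∧ ∀ l ∈ S, l ⊆ zeroSet g := by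
  have h1 := finrank_polysLE_le S hS m
  have h2 := six_mul_finrank_polysLE m
  have h3 : 0 < Module.finrank ℝ (vanishing S m) := by
    by_contra h0
    have h0 : Module.finrank ℝ (vanishing S m) = 0 := by omega
    rw [h0] at h1
    nlinarith
  obtain ⟨g, hg, hg0⟩ := Submodule.exists_mem_ne_zero_of_ne_bot
    (Submodule.one_le_finrank_iff.1 h3)
  exact ⟨g, hg0, hg.1, hg.2⟩

/-- A plane containing the line `m` but not the line `l`. -/
lemma exists_plane {l m : Set Pt} (hl : IsLine l) (hm : IsLine m) (hlm : l ≠ m) :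
    ∃ π : Poly, π.totalDegree ≤ 1 ∧ m ⊆ zeroSet π ∧ ¬ l ⊆ zeroSet π := by
  obtain ⟨x, hxl, hxm⟩ : ∃ x ∈ l, x ∉ m := by
    by_contra! hsub
    obtain ⟨p, hp, q, hq, hpq⟩ := hl.infinite.nontrivial
    exact hlm (hl.eq_of_two_mem hm hpq hp hq (hsub p hp) (hsub q hq))
  obtain ⟨p, v, hv, rfl⟩ := hm
  have hx : x - p ∉ Submodule.span ℝ {v} := by
    rw [Submodule.mem_span_singleton]
    rintro ⟨t, ht⟩
    exact hxm ⟨t, by rw [ht]; abel⟩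
  obtain ⟨φ, hφx, hφ⟩ := Submodule.exists_le_ker_of_notMem hx
  have hφv : φ v = 0 := by
    have := hφ (Submodule.mem_span_singleton_self v)
    simpa using this
  set π : Poly := ∑ i, C (φ (Pi.single i 1)) * (X i - C (p i)) with hπ
  have hev : ∀ y, eval y π = φ (y - p) := by
    intro y
    rw [LinearMap.pi_apply_eq_sum_univ φ (y - p), hπ, map_sum]
    refine Finset.sum_congr rfl fun i _ => ?_
    have : (fun j => if i = j then (1 : ℝ) else 0) = Pi.single i 1 := by
      ext j
      rw [Pi.single_apply, if_congr eq_comm rfl rfl]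
    simp [this, mul_comm]
  refine ⟨π, ?_, ?_, fun h => hφx ?_⟩
  · refine totalDegree_finsetSum_le fun i _ => ?_
    refine (totalDegree_mul _ _).trans ?_
    rw [totalDegree_C, zero_add]
    refine (totalDegree_sub _ _).trans ?_
    simp
  · rintro _ ⟨t, rfl⟩
    rw [mem_zeroSet, hev]
    simp [hφv]
  · rw [← hev]
    exact h hxl

lemma le_finrank_map_restr (S : Finset (Set Pt)) (hS : ∀ l ∈ S, IsLine l) (m : ℕ) {p v : Pt}
    (hv : v ≠ 0) (hl : line p v ∉ S) :
    m + 1 ≤ Module.finrank ℝ ((vanishing S m).map (restr p v).toLinearMap) + S.card := by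
  rcases lt_or_ge m S.card with hm | hm
  · omega
  choose! π hπ using fun l (h : l ∈ S) =>
    exists_plane (isLine_line p hv) (hS l h) (fun h' => hl (h' ▸ h))
  obtain ⟨i, hi⟩ : ∃ i, v i ≠ 0 := by
    by_contra! h
    exact hv (funext h)
  set c : Poly := ∏ l ∈ S, π l with hc
  have hcdeg : c.totalDegree ≤ S.card := by
    refine (totalDegree_finsetProd S π).trans ?_
    refine (Finset.sum_le_card_nsmul S _ 1 fun l hl => (hπ l hl).1).trans ?_
    simp
  have hc0 : restr p v c ≠ 0 := by
    rw [hc, map_prod, Finset.prod_ne_zero_iff]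
    intro l hl h
    exact (hπ l hl).2.2 ((restr_eq_zero_iff p v _).1 h)
  set lam : Poly := C (v i)⁻¹ * (X i - C (p i)) with hlam
  have hlam1 : restr p v lam = Polynomial.X := by
    simp only [hlam, restr, map_mul, map_sub, aeval_X, Polynomial.algebraMap_eq,
      algHom_C]
    rw [add_sub_cancel_left, ← mul_assoc, ← Polynomial.C_mul, inv_mul_cancel₀ hi,
      Polynomial.C_1, one_mul]
  have hlamdeg : lam.totalDegree ≤ 1 := by
    refine (totalDegree_mul _ _).trans ?_
    rw [totalDegree_C, zero_add]
    refine (totalDegree_sub _ _).trans ?_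
    simp
  have hle : (Polynomial.degreeLT ℝ (m + 1 - S.card)).map
      (LinearMap.mulLeft ℝ (restr p v c)) ≤ (vanishing S m).map (restr p v).toLinearMap := by
    rintro _ ⟨q, hq, rfl⟩
    refine ⟨c * Polynomial.aeval lam q, ⟨?_, ?_⟩, ?_⟩
    · refine (totalDegree_mul _ _).trans ?_
      have : (Polynomial.aeval lam q).totalDegree ≤ m - S.card := by
        rw [Polynomial.aeval_eq_sum_range]
        refine totalDegree_finsetSum_le fun k hk => ?_
        refine (totalDegree_smul_le _ _).trans ((totalDegree_pow _ _).trans ?_)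
        have hq' : q.natDegree ≤ m - S.card := by
          rcases eq_or_ne q 0 with rfl | hq0
          · simp
          · have := (Polynomial.natDegree_lt_iff_degree_lt hq0).2 (Polynomial.mem_degreeLT.1 hq)
            omega
        have : k ≤ m - S.card := by
          rw [Finset.mem_range] at hk
          omega
        nlinarith
      omega
    · intro l hl x hx
      have : eval x (π l) = 0 := (hπ l hl).2.1 hx
      rw [mem_zeroSet, map_mul, hc, map_prod, Finset.prod_eq_zero hl this, zero_mul]
    · have h2 : restr p v (Polynomial.aeval lam q) = q := by
        rw [← Polynomial.aeval_algHom_apply, hlam1, Polynomial.aeval_X_left_apply]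
      simp [h2]
  have h3 := Submodule.finrank_mono hle
  have hinj : Function.Injective (LinearMap.mulLeft ℝ (restr p v c)) :=
    fun a b hab => mul_left_cancel₀ hc0 hab
  rw [← (Submodule.equivMapOfInjective _ hinj _).finrank_eq,
    (Polynomial.degreeLTEquiv ℝ (m + 1 - S.card)).finrank_eq, Module.finrank_fin_fun] at h3
  omega

lemma finrank_vanishing_add_le (S : Finset (Set Pt)) (hS : ∀ l ∈ S, IsLine l) (m : ℕ) :
    Module.finrank ℝ (vanishing S m) + S.card * (m + 1) ≤
      Module.finrank ℝ (polysLE m) + S.card * S.card := by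
  induction S using Finset.induction_on with
  | empty => simp [finrank_vanishing_empty]
  | insert l S hl ih =>
    have hS' : ∀ l ∈ S, IsLine l := fun l hl => hS l (Finset.mem_insert_of_mem hl)
    have ih := ih hS'
    obtain ⟨p, v, hv, rfl⟩ := hS l (Finset.mem_insert_self _ _)
    have h1 := finrank_vanishing_insert S m p v
    have h2 := le_finrank_map_restr S hS' m hv hl
    rw [Finset.card_insert_of_notMem hl]
    change Module.finrank ℝ (vanishing (insert (line p v) S) m) + _ ≤ _
    nlinarith

/-- Lower bound for the degree `k + deg f + deg g` part of the ideal `(f, g)`. -/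
lemma finrank_polysLE_add_le {f g : Poly} (hf : Irreducible f) (hfg : ¬ f ∣ g)
    (S : Finset (Set Pt)) (hSf : ∀ l ∈ S, l ⊆ zeroSet f) (hSg : ∀ l ∈ S, l ⊆ zeroSet g) (k : ℕ) :
    Module.finrank ℝ (polysLE (k + g.totalDegree)) +
      Module.finrank ℝ (polysLE (k + f.totalDegree)) ≤ Module.finrank ℝ (polysLE k) +
        Module.finrank ℝ (vanishing S (k + f.totalDegree + g.totalDegree)) := by
  set D := f.totalDegree with hD
  set E := g.totalDegree with hE
  have hmul : ∀ {a b : ℕ} {q : Poly}, q.totalDegree ≤ b → ∀ r ∈ polysLE a,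
      LinearMap.mulLeft ℝ q r ∈ polysLE (a + b) := by
    intro a b q hq r hr
    rw [mem_polysLE] at *
    exact (totalDegree_mul _ _).trans (by omega)
  set Φ : polysLE (k + E) × polysLE (k + D) →ₗ[ℝ] Poly :=
    ((LinearMap.mulLeft ℝ f).domRestrict _).coprod ((LinearMap.mulLeft ℝ g).domRestrict _) with hΦ
  set Ψ : polysLE k →ₗ[ℝ] polysLE (k + E) × polysLE (k + D) :=
    ((LinearMap.mulLeft ℝ g).restrict (hmul hE.ge)).prod
      (-(LinearMap.mulLeft ℝ f).restrict (hmul hD.ge)) with hΨ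
  have hker : LinearMap.ker Φ ≤ LinearMap.range Ψ := by
    rintro ⟨⟨a, ha⟩, ⟨b, hb⟩⟩ hab
    have hab : f * a + g * b = 0 := by simpa [hΦ] using hab
    rw [mem_polysLE] at ha hb
    have hdvd : f ∣ b := by
      refine (hf.prime.dvd_or_dvd (a := g) (b := b) ⟨-a, ?_⟩).resolve_left hfg
      linear_combination hab
    obtain ⟨c, rfl⟩ := hdvd
    have ha' : a = -(g * c) := by
      refine mul_left_cancel₀ hf.ne_zero ?_
      linear_combination hab
    have hc : c.totalDegree ≤ k := by
      rcases eq_or_ne c 0 with rfl | hc0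
      · simp
      · rw [totalDegree_mul_of_isDomain hf.ne_zero hc0] at hb
        omega
    refine ⟨⟨-c, mem_polysLE.2 (by rwa [totalDegree_neg])⟩, ?_⟩
    refine Prod.ext (Subtype.ext ?_) (Subtype.ext ?_)
    · simp [hΨ, ha']
    · simp [hΨ]
  have hrange : LinearMap.range Φ ≤ vanishing S (k + D + E) := by
    rintro _ ⟨⟨⟨a, ha⟩, ⟨b, hb⟩⟩, rfl⟩
    rw [mem_polysLE] at ha hb
    have h : Φ (⟨a, mem_polysLE.2 ha⟩, ⟨b, mem_polysLE.2 hb⟩) = f * a + g * b := by simp [hΦ]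
    rw [h]
    refine ⟨(totalDegree_add _ _).trans (max_le ?_ ?_), fun l hl x hx => ?_⟩
    · exact (totalDegree_mul _ _).trans (by omega)
    · exact (totalDegree_mul _ _).trans (by omega)
    · have h1 := hSf l hl hx
      have h2 := hSg l hl hx
      rw [mem_zeroSet] at *
      simp [h1, h2]
  have h1 := Φ.finrank_range_add_finrank_ker
  rw [Module.finrank_prod] at h1
  have h2 := Submodule.finrank_mono hker
  have h3 := Submodule.finrank_mono hrange
  have h4 := LinearMap.finrank_range_le Ψ
  omega

/-- Bézout's inequality for lines: an irreducible surface and a surface not containing it share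
at most as many lines as the product of the degrees. -/
theorem card_common_lines_le {f g : Poly} (hf : Irreducible f) (hfg : ¬ f ∣ g)
    (S : Finset (Set Pt)) (hS : ∀ l ∈ S, IsLine l) (hSf : ∀ l ∈ S, l ⊆ zeroSet f)
    (hSg : ∀ l ∈ S, l ⊆ zeroSet g) : S.card ≤ f.totalDegree * g.totalDegree := by
  by_contra! hlt
  set D := f.totalDegree with hD
  set E := g.totalDegree with hE
  set N := S.card with hN
  set k := N * N + D * E * (2 + D + E) with hk
  have h1 := finrank_polysLE_add_le hf hfg S hSf hSg k
  have h2 := finrank_vanishing_add_le S hS (k + D + E)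
  have e1 := six_mul_finrank_polysLE k
  have e2 := six_mul_finrank_polysLE (k + D)
  have e3 := six_mul_finrank_polysLE (k + E)
  have e4 := six_mul_finrank_polysLE (k + D + E)
  rw [← hN] at h2
  rw [← hD, ← hE] at h1
  have key : 6 * (N * (k + D + E + 1)) ≤ 6 * (N * N) + 6 * (D * E) * (k + 2)
      + 3 * (D * E) * (D + E) := by
    zify at *
    linarith
  have h5 : (D * E + 1) * (k + D + E + 1) ≤ N * (k + D + E + 1) := Nat.mul_le_mul_right _ hlt
  have h6 : 0 ≤ D * E * (D + E) := Nat.zero_le _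
  nlinarith

/-- The directional derivative of a polynomial. -/
noncomputable def dd (v : Pt) : Poly →ₗ[ℝ] Poly := ∑ i, v i • (pderiv i).toLinearMap

lemma dd_apply (v : Pt) (f : Poly) : dd v f = ∑ i, v i • pderiv i f := by
  simp [dd, LinearMap.sum_apply]

lemma dd_add (v w : Pt) (f : Poly) : dd (v + w) f = dd v f + dd w f := by
  simp [dd_apply, add_smul, Finset.sum_add_distrib]

lemma dd_smul (c : ℝ) (v : Pt) (f : Poly) : dd (c • v) f = c • dd v f := by
  simp [dd_apply, Finset.smul_sum, smul_smul]

lemma dd_neg (v : Pt) (f : Poly) : dd (-v) f = -dd v f := by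
  simp [dd_apply]

lemma dd_sub (v w : Pt) (f : Poly) : dd (v - w) f = dd v f - dd w f := by
  rw [sub_eq_add_neg, dd_add, dd_neg, sub_eq_add_neg]

lemma pderiv_comm (i j : Fin 3) (f : Poly) : pderiv i (pderiv j f) = pderiv j (pderiv i f) := by
  have h : ⁅(pderiv i : Derivation ℝ Poly Poly), (pderiv j : Derivation ℝ Poly Poly)⁆ = 0 := by
    refine derivation_ext fun k => ?_
    rw [Derivation.commutator_apply, pderiv_X, pderiv_X]
    simp only [Pi.single_apply]
    split_ifs <;> simp
  have := congrArg (fun d : Derivation ℝ Poly Poly => d f) h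
  simpa [Derivation.commutator_apply, sub_eq_zero] using this

lemma dd_comm (v w : Pt) (f : Poly) : dd v (dd w f) = dd w (dd v f) := by
  simp only [dd_apply, map_sum, Derivation.map_smul]
  rw [Finset.sum_comm]
  refine Finset.sum_congr rfl fun i _ => Finset.sum_congr rfl fun j _ => ?_
  rw [pderiv_comm, smul_comm]

lemma totalDegree_pderiv_le (i : Fin 3) (f : Poly) :
    (pderiv i f).totalDegree ≤ f.totalDegree - 1 := by
  conv_lhs => rw [f.as_sum, map_sum]
  refine totalDegree_finsetSum_le fun s hs => ?_
  rw [pderiv_monomial]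
  rcases Nat.eq_zero_or_pos (s i) with h | h
  · simp [h]
  · refine (totalDegree_monomial_le _ _).trans ?_
    have h1 : (s.sum fun _ e => e) ≤ f.totalDegree := le_totalDegree hs
    have h2 : s - Finsupp.single i 1 + Finsupp.single i 1 = s :=
      tsub_add_cancel_of_le (by simpa [Nat.one_le_iff_ne_zero, Nat.pos_iff_ne_zero] using h)
    have h3 : ((s - Finsupp.single i 1).sum fun _ e => e) + 1 = s.sum fun _ e => e := by
      conv_rhs => rw [← h2]
      rw [Finsupp.sum_add_index' (fun _ => rfl) (fun _ _ _ => rfl), Finsupp.sum_single_index rfl]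
    change ((s - Finsupp.single i 1).sum fun _ e => e) ≤ _
    omega

lemma totalDegree_dd_le (v : Pt) (f : Poly) : (dd v f).totalDegree ≤ f.totalDegree - 1 := by
  rw [dd_apply]
  exact totalDegree_finsetSum_le fun i _ =>
    (totalDegree_smul_le _ _).trans (totalDegree_pderiv_le i f)

lemma hasDerivAt_eval {γ : ℝ → Pt} {γ' : Pt} {t : ℝ} (h : HasDerivAt γ γ' t) (f : Poly) :
    HasDerivAt (fun s => eval (γ s) f) (eval (γ t) (dd γ' f)) t := by
  induction f using MvPolynomial.induction_on with
  | C a => simpa [dd_apply] using hasDerivAt_const t a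
  | add p q hp hq =>
    simp only [map_add]
    exact hp.add hq
  | mul_X p i hp =>
    have hi : HasDerivAt (fun s => γ s i) (γ' i) t := (hasDerivAt_pi.1 h) i
    have := hp.mul hi
    simp only [map_mul, eval_X]
    refine this.congr_deriv ?_
    simp only [dd_apply, Derivation.leibniz, map_sum, smul_eval, smul_eq_mul, map_add,
      map_mul, eval_X, pderiv_X, mul_add, Finset.sum_add_distrib, Finset.sum_mul]
    rw [add_comm]
    congr 1
    · simp only [Pi.single_apply, apply_ite (eval (γ t)), map_one, map_zero]
      simp [mul_comm]
    · exact Finset.sum_congr rfl fun j _ => by ring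

lemma hasDerivAt_eval_dd {γ v : ℝ → Pt} {γ' v' : Pt} {t : ℝ} (h : HasDerivAt γ γ' t)
    (hv : HasDerivAt v v' t) (f : Poly) :
    HasDerivAt (fun s => eval (γ s) (dd (v s) f))
      (eval (γ t) (dd γ' (dd (v t) f)) + eval (γ t) (dd v' f)) t := by
  have hs : ∀ i, HasDerivAt (fun s => v s i * eval (γ s) (pderiv i f))
      (v' i * eval (γ t) (pderiv i f) + v t i * eval (γ t) (dd γ' (pderiv i f))) t :=
    fun i => ((hasDerivAt_pi.1 hv) i).mul (hasDerivAt_eval h _)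
  have := HasDerivAt.fun_sum (u := Finset.univ) fun i _ => hs i
  simp only [dd_apply (v _), dd_apply v', map_sum, map_smul, smul_eval]
  refine this.congr_deriv ?_
  rw [Finset.sum_add_distrib, add_comm]

lemma hasDerivAt_eval_dd_dd {γ v w : ℝ → Pt} {γ' v' w' : Pt} {t : ℝ} (h : HasDerivAt γ γ' t)
    (hv : HasDerivAt v v' t) (hw : HasDerivAt w w' t) (f : Poly) :
    HasDerivAt (fun s => eval (γ s) (dd (v s) (dd (w s) f)))
      (eval (γ t) (dd γ' (dd (v t) (dd (w t) f))) + eval (γ t) (dd v' (dd (w t) f))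
        + eval (γ t) (dd (v t) (dd w' f))) t := by
  have hs : ∀ i, HasDerivAt (fun s => w s i * eval (γ s) (dd (v s) (pderiv i f)))
      (w' i * eval (γ t) (dd (v t) (pderiv i f)) + w t i *
        (eval (γ t) (dd γ' (dd (v t) (pderiv i f))) + eval (γ t) (dd v' (pderiv i f)))) t :=
    fun i => ((hasDerivAt_pi.1 hw) i).mul (hasDerivAt_eval_dd h hv _)
  have := HasDerivAt.fun_sum (u := Finset.univ) fun i _ => hs i
  simp only [dd_apply (w _), dd_apply w', map_sum, map_smul, smul_eval]
  refine this.congr_deriv ?_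
  simp only [mul_add, Finset.sum_add_distrib]
  ring

lemma contDiff_eval (f : Poly) {n : WithTop ℕ∞} : ContDiff ℝ n fun x : Pt => eval x f := by
  have h := AnalyticOnNhd.eval_mvPolynomial (𝕜 := ℝ) f
  exact contDiffOn_univ.1 (h.contDiffOn uniqueDiffOn_univ)

lemma continuous_eval_poly (f : Poly) : Continuous fun x : Pt => eval x f :=
  MvPolynomial.continuous_eval f

lemma hasDerivAt_line (p v : Pt) (t : ℝ) : HasDerivAt (fun s : ℝ => p + s • v) v t := by
  simpa using ((hasDerivAt_id t).smul_const v).const_add p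

/-- A polynomial vanishing on a line has vanishing derivative along the line. -/
lemma line_subset_zeroSet_dd {p v : Pt} {f : Poly} (h : line p v ⊆ zeroSet f) :
    line p v ⊆ zeroSet (dd v f) := by
  intro x hx
  obtain ⟨t, ht⟩ := hx
  have h1 := hasDerivAt_eval (hasDerivAt_line p v t) f
  have h2 : ∀ s : ℝ, eval (p + s • v) f = 0 := fun s => mem_zeroSet.1 (h (mem_line p v s))
  simp only [h2] at h1
  rw [mem_zeroSet, ht]
  exact h1.unique (hasDerivAt_const t (0 : ℝ))

lemma line_jets {p v : Pt} {f : Poly} (h : line p v ⊆ zeroSet f) :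
    eval p f = 0 ∧ eval p (dd v f) = 0 ∧ eval p (dd v (dd v f)) = 0 ∧
      eval p (dd v (dd v (dd v f))) = 0 := by
  have hp : p ∈ line p v := ⟨0, by simp⟩
  have h1 := line_subset_zeroSet_dd h
  have h2 := line_subset_zeroSet_dd h1
  exact ⟨mem_zeroSet.1 (h hp), mem_zeroSet.1 (h1 hp), mem_zeroSet.1 (h2 hp),
    mem_zeroSet.1 (line_subset_zeroSet_dd h2 hp)⟩

lemma exists_pderiv_ne_zero {f : Poly} (hf : Irreducible f) : ∃ i, pderiv i f ≠ 0 := by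
  by_contra! h
  have hdd : ∀ v, dd v f = 0 := fun v => by simp [dd_apply, h]
  have hconst : f = C (eval 0 f) := by
    refine MvPolynomial.funext fun x => ?_
    rw [eval_C]
    have hd : ∀ t : ℝ, HasDerivAt (fun s : ℝ => eval ((0 : Pt) + s • x) f) 0 t := fun t => by
      simpa [hdd] using hasDerivAt_eval (hasDerivAt_line 0 x t) f
    have := is_const_of_deriv_eq_zero (fun t => (hd t).differentiableAt) (fun t => (hd t).deriv) 1 0
    simpa using this
  rcases eq_or_ne (eval 0 f) 0 with h0 | h0
  · rw [h0, C_0] at hconst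
    exact hf.ne_zero hconst
  · refine hf.not_isUnit ?_
    rw [hconst]
    exact (isUnit_iff_ne_zero.2 h0).map C

open Topology Filter

lemma line_subset_zeroSet_of_eventually {p v : Pt} {f : Poly}
    (h : ∀ᶠ t : ℝ in 𝓝 0, eval (p + t • v) f = 0) : line p v ⊆ zeroSet f := by
  rw [← restr_eq_zero_iff]
  refine Polynomial.eq_zero_of_infinite_isRoot _ ?_
  obtain ⟨ε, hε, hb⟩ := Metric.eventually_nhds_iff_ball.1 h
  refine Set.Infinite.mono (s := Metric.ball 0 ε) (fun t ht => ?_) ?_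
  · rw [Set.mem_ofPred_eq, Polynomial.IsRoot, eval_restr]
    exact hb t ht
  · rw [Real.ball_eq_Ioo]
    exact Set.Ioo_infinite (by linarith)

/-- Integral curves of a field of asymptotic directions with vanishing third order terms are
straight. -/
lemma line_subset_of_field {f : Poly} {x₀ ea eb e3 : Pt} {β δ : Pt → ℝ}
    (hβ : ContDiffAt ℝ 1 β x₀) (hδ : ContDiffAt ℝ 1 δ x₀) (hx₀ : eval x₀ f = 0)
    {v : Pt → Pt} (hv : ∀ x, v x = ea + β x • eb + δ x • e3)
    (h1 : ∀ᶠ x in 𝓝 x₀, eval x (dd (v x) f) = 0)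
    (h2 : ∀ᶠ x in 𝓝 x₀, eval x (dd (v x) (dd (v x) f)) = 0)
    (h3 : ∀ᶠ x in 𝓝 x₀, eval x f = 0 → eval x (dd (v x) (dd (v x) (dd (v x) f))) = 0)
    (hdet : ∀ᶠ x in 𝓝 x₀, eval x (dd e3 f) * eval x (dd (v x) (dd eb f)) -
      eval x (dd eb f) * eval x (dd (v x) (dd e3 f)) ≠ 0) :
    line x₀ (v x₀) ⊆ zeroSet f := by
  have hvC : ContDiffAt ℝ 1 v x₀ := by
    have : v = fun x => ea + β x • eb + δ x • e3 := funext hv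
    rw [this]
    exact (contDiffAt_const.add (hβ.smul contDiffAt_const)).add (hδ.smul contDiffAt_const)
  obtain ⟨γ, hγ0, ε, hε, hγ⟩ :=
    hvC.exists_forall_mem_closedBall_exists_eq_forall_mem_Ioo_hasDerivAt₀ 0
  have hcont : ContinuousAt γ 0 := (hγ 0 ⟨by linarith, by linarith⟩).continuousAt
  have hpull : ∀ {P : Pt → Prop}, (∀ᶠ x in 𝓝 x₀, P x) → ∀ᶠ t in 𝓝 (0 : ℝ), P (γ t) := by
    intro P hP
    exact hcont.eventually (by rwa [hγ0])
  have hIoo : ∀ᶠ t in 𝓝 (0 : ℝ), t ∈ Set.Ioo (0 - ε) (0 + ε) :=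
    Ioo_mem_nhds (by linarith) (by linarith)
  have hall := hIoo.and <| (hpull h1).and <| (hpull h2).and <| (hpull h3).and <|
    (hpull hdet).and <| (hpull (hβ.eventually (by simp))).and (hpull (hδ.eventually (by simp)))
  obtain ⟨η, hη, hall⟩ := Metric.eventually_nhds_iff_ball.1 hall
  have hopen : IsOpen (Metric.ball (0 : ℝ) η) := Metric.isOpen_ball
  have hconn : IsPreconnected (Metric.ball (0 : ℝ) η) := (convex_ball _ _).isPreconnected
  have h0 : (0 : ℝ) ∈ Metric.ball (0 : ℝ) η := Metric.mem_ball_self hη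
  have hconst : ∀ {E : Type} [NormedAddCommGroup E] [NormedSpace ℝ E] (g : ℝ → E),
      (∀ t ∈ Metric.ball (0 : ℝ) η, HasDerivAt g 0 t) →
      ∀ t ∈ Metric.ball (0 : ℝ) η, g t = g 0 := by
    intro E _ _ g hg t ht
    exact hopen.is_const_of_deriv_eq_zero hconn
      (fun s hs => (hg s hs).differentiableAt.differentiableWithinAt)
      (fun s hs => (hg s hs).deriv) ht h0
  have hf : ∀ t ∈ Metric.ball (0 : ℝ) η, eval (γ t) f = 0 := by
    intro t ht
    rw [hconst (fun t => eval (γ t) f) ?_ t ht, hγ0, hx₀]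
    intro s hs
    have := hasDerivAt_eval (hγ s (hall s hs).1) f
    rwa [(hall s hs).2.1] at this
  have hzero : ∀ (g : ℝ → ℝ) (g' t : ℝ), t ∈ Metric.ball (0 : ℝ) η →
      (∀ s ∈ Metric.ball (0 : ℝ) η, g s = 0) → HasDerivAt g g' t → g' = 0 := by
    intro g g' t ht hg hd
    refine hd.unique ((hasDerivAt_const t (0 : ℝ)).congr_of_eventuallyEq ?_)
    filter_upwards [hopen.mem_nhds ht] with s hs using hg s hs
  have hder : ∀ t ∈ Metric.ball (0 : ℝ) η,
      HasDerivAt (fun s => β (γ s)) 0 t ∧ HasDerivAt (fun s => δ (γ s)) 0 t := by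
    intro t ht
    obtain ⟨hI, -, hb, hc, hd, hβt, hδt⟩ := hall t ht
    have hγt := hγ t hI
    obtain ⟨b', hb'⟩ : ∃ b', HasDerivAt (fun s => β (γ s)) b' t :=
      ⟨_, ((hβt.differentiableAt (by simp)).hasFDerivAt.comp_hasDerivAt t hγt)⟩
    obtain ⟨d', hd'⟩ : ∃ d', HasDerivAt (fun s => δ (γ s)) d' t :=
      ⟨_, ((hδt.differentiableAt (by simp)).hasFDerivAt.comp_hasDerivAt t hγt)⟩
    have hv' : HasDerivAt (fun s => v (γ s)) (b' • eb + d' • e3) t := by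
      simp only [hv]
      exact ((hb'.smul_const eb).const_add ea).add (hd'.smul_const e3)
    have e1 := hzero _ _ t ht (fun s hs => (hall s hs).2.1) (hasDerivAt_eval_dd hγt hv' f)
    have e2 := hzero _ _ t ht (fun s hs => (hall s hs).2.2.1)
      (hasDerivAt_eval_dd_dd hγt hv' hv' f)
    rw [hb, zero_add] at e1
    rw [hc (hf t ht), zero_add, dd_comm] at e2
    simp only [dd_add, dd_smul, map_add, map_smul, smul_eval] at e1 e2
    have k1 : b' * (eval (γ t) (dd e3 f) * eval (γ t) (dd (v (γ t)) (dd eb f)) -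
      eval (γ t) (dd eb f) * eval (γ t) (dd (v (γ t)) (dd e3 f))) = 0 := by
      linear_combination (1 / 2) * eval (γ t) (dd e3 f) * e2 - eval (γ t) (dd (v (γ t)) (dd e3 f)) * e1
    have k2 : d' * (eval (γ t) (dd e3 f) * eval (γ t) (dd (v (γ t)) (dd eb f)) -
      eval (γ t) (dd eb f) * eval (γ t) (dd (v (γ t)) (dd e3 f))) = 0 := by
      linear_combination eval (γ t) (dd (v (γ t)) (dd eb f)) * e1 - (1 / 2) * eval (γ t) (dd eb f) * e2
    have k1' := (mul_eq_zero.1 k1).resolve_right hd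
    have k2' := (mul_eq_zero.1 k2).resolve_right hd
    exact ⟨k1' ▸ hb', k2' ▸ hd'⟩
  have hvc : ∀ t ∈ Metric.ball (0 : ℝ) η, v (γ t) = v x₀ := by
    intro t ht
    have e1 := hconst _ (fun s hs => (hder s hs).1) t ht
    have e2 := hconst _ (fun s hs => (hder s hs).2) t ht
    rw [hv, hv, e1, e2, hγ0]
  have hγl : ∀ t ∈ Metric.ball (0 : ℝ) η, γ t = x₀ + t • v x₀ := by
    intro t ht
    have := hconst (fun t => γ t - t • v x₀) (fun s hs => by
      have k1 := hγ s (hall s hs).1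
      rw [hvc s hs] at k1
      have k2 := k1.fun_sub ((hasDerivAt_id s).smul_const (v x₀))
      rwa [one_smul, sub_self] at k2) t ht
    simp only [hγ0, zero_smul, sub_zero] at this
    exact sub_eq_iff_eq_add.1 this
  refine line_subset_zeroSet_of_eventually ?_
  filter_upwards [hopen.mem_nhds h0] with t ht
  rw [← hγl t ht]
  exact hf t ht

lemma exists_line_field {f : Poly} {p ea eb e3 : Pt} (ha : eval p (dd ea f) = 0)
    (hb : eval p (dd eb f) = 0) (h3 : eval p (dd e3 f) ≠ 0)
    (haa : eval p (dd ea (dd ea f)) = 0) (hab : 0 < eval p (dd ea (dd eb f)))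
    (hF : ∀ᶠ x in 𝓝 p, eval x f = 0 → ∀ v, eval x (dd v f) = 0 → eval x (dd v (dd v f)) = 0 →
      eval x (dd v (dd v (dd v f))) = 0) :
    ∃ v : Pt → Pt, ContinuousAt v p ∧ v p = ea ∧
      ∀ᶠ x in 𝓝 p, eval x f = 0 → line x (v x) ⊆ zeroSet f := by
  obtain ⟨g, hg0⟩ : ∃ g : Poly → Pt → ℝ, g = fun q x => eval x q :=
    ⟨_, rfl⟩
  obtain ⟨c1, hc1⟩ : ∃ c1 : Pt → ℝ, c1 = fun x => g (dd ea f) x / g (dd e3 f) x :=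
    ⟨_, rfl⟩
  obtain ⟨c2, hc2⟩ : ∃ c2 : Pt → ℝ, c2 = fun x => g (dd eb f) x / g (dd e3 f) x :=
    ⟨_, rfl⟩
  obtain ⟨A, hA⟩ : ∃ A : Pt → ℝ, A = fun x => g (dd ea (dd ea f)) x - 2 * c1 x * g (dd ea (dd e3 f)) x +
    c1 x ^ 2 * g (dd e3 (dd e3 f)) x :=
    ⟨_, rfl⟩
  obtain ⟨B, hB⟩ : ∃ B : Pt → ℝ, B = fun x => g (dd ea (dd eb f)) x - c2 x * g (dd ea (dd e3 f)) x -
    c1 x * g (dd eb (dd e3 f)) x + c1 x * c2 x * g (dd e3 (dd e3 f)) x :=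
    ⟨_, rfl⟩
  obtain ⟨C, hC⟩ : ∃ C : Pt → ℝ, C = fun x => g (dd eb (dd eb f)) x - 2 * c2 x * g (dd eb (dd e3 f)) x +
    c2 x ^ 2 * g (dd e3 (dd e3 f)) x :=
    ⟨_, rfl⟩
  obtain ⟨T, hT⟩ : ∃ T : Pt → ℝ, T = fun x => B x ^ 2 - A x * C x :=
    ⟨_, rfl⟩
  obtain ⟨S, hS⟩ : ∃ S : Pt → ℝ, S = fun x => √(T x) :=
    ⟨_, rfl⟩
  obtain ⟨β, hβ⟩ : ∃ β : Pt → ℝ, β = fun x => -A x / (B x + S x) :=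
    ⟨_, rfl⟩
  obtain ⟨δ, hδ⟩ : ∃ δ : Pt → ℝ, δ = fun x => -(c1 x + β x * c2 x) :=
    ⟨_, rfl⟩
  have hg : ∀ q, ContDiffAt ℝ 1 (g q) p := fun q => by
    rw [hg0]
    exact (contDiff_eval q).contDiffAt
  have hc1p : c1 p = 0 := by simp [hc1, hg0, ha]
  have hc2p : c2 p = 0 := by simp [hc2, hg0, hb]
  have hAp : A p = 0 := by simp [hA, hc1p, hg0, haa]
  have hBp : 0 < B p := by simpa [hB, hc1p, hc2p, hg0] using hab
  have hTp : T p = B p ^ 2 := by simp [hT, hAp]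
  have hSp : S p = B p := by simp only [hS, hTp]; exact Real.sqrt_sq hBp.le
  have hβp : β p = 0 := by simp [hβ, hAp]
  have hδp : δ p = 0 := by simp [hδ, hβp, hc1p]
  have h3g : g (dd e3 f) p ≠ 0 := by simpa [hg0] using h3
  have kc1 : ContDiffAt ℝ 1 c1 p := by
    rw [hc1]
    exact (hg _).div (hg _) h3g
  have kc2 : ContDiffAt ℝ 1 c2 p := by
    rw [hc2]
    exact (hg _).div (hg _) h3g
  have kA : ContDiffAt ℝ 1 A p := by
    rw [hA]
    exact ((hg _).sub ((contDiffAt_const.mul kc1).mul (hg _))).add ((kc1.pow 2).mul (hg _))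
  have kB : ContDiffAt ℝ 1 B p := by
    rw [hB]
    exact (((hg _).sub (kc2.mul (hg _))).sub (kc1.mul (hg _))).add ((kc1.mul kc2).mul (hg _))
  have kC : ContDiffAt ℝ 1 C p := by
    rw [hC]
    exact ((hg _).sub ((contDiffAt_const.mul kc2).mul (hg _))).add ((kc2.pow 2).mul (hg _))
  have kT : ContDiffAt ℝ 1 T p := by
    rw [hT]
    exact (kB.pow 2).sub (kA.mul kC)
  have kS : ContDiffAt ℝ 1 S p := by
    rw [hS]
    exact kT.sqrt (by rw [hTp]; positivity)
  have kβ : ContDiffAt ℝ 1 β p := by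
    rw [hβ]
    exact kA.neg.div (kB.add kS) (by rw [hSp]; positivity)
  have kδ : ContDiffAt ℝ 1 δ p := by
    rw [hδ]
    exact (kc1.add (kβ.mul kc2)).neg
  obtain ⟨v, hv⟩ : ∃ v : Pt → Pt, v = fun x => ea + β x • eb + δ x • e3 := ⟨_, rfl⟩
  refine ⟨v, ?_, by simp [hv, hβp, hδp], ?_⟩
  · rw [hv]
    exact (continuousAt_const.add (kβ.continuousAt.smul continuousAt_const)).add
      (kδ.continuousAt.smul continuousAt_const)
  have e3ne : ∀ᶠ x in 𝓝 p, g (dd e3 f) x ≠ 0 := (hg _).continuousAt.eventually_ne h3g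
  have eT : ∀ᶠ x in 𝓝 p, 0 < T x :=
    kT.continuousAt.eventually (lt_mem_nhds (by rw [hTp]; positivity))
  have eB : ∀ᶠ x in 𝓝 p, 0 < B x := kB.continuousAt.eventually (lt_mem_nhds hBp)
  have key : ∀ᶠ x in 𝓝 p, eval x (dd (v x) f) = 0 ∧ eval x (dd (v x) (dd (v x) f)) = 0 ∧
      eval x (dd e3 f) * eval x (dd (v x) (dd eb f)) -
        eval x (dd eb f) * eval x (dd (v x) (dd e3 f)) ≠ 0 := by
    filter_upwards [e3ne, eT, eB] with x h3x hTx hBx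
    have hSx : 0 < S x := by simpa [hS] using hTx
    have hS2 : S x ^ 2 = B x ^ 2 - A x * C x := by
      rw [← congrFun hT x, hS]
      exact Real.sq_sqrt hTx.le
    rw [hg0] at h3x
    have hd1 : c1 x * eval x (dd e3 f) = eval x (dd ea f) := by
      rw [hc1, hg0]
      exact div_mul_cancel₀ _ h3x
    have hd2 : c2 x * eval x (dd e3 f) = eval x (dd eb f) := by
      rw [hc2, hg0]
      exact div_mul_cancel₀ _ h3x
    have hβx : β x * (B x + S x) = -A x := by
      rw [hβ]
      exact div_mul_cancel₀ _ (by positivity)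
    have hBC : B x + β x * C x = S x := by
      have : (B x + S x) * (B x + β x * C x - S x) = 0 := by
        linear_combination C x * hβx - hS2
      have := (mul_eq_zero.1 this).resolve_left (by positivity)
      linarith
    have e1 : eval x (dd (v x) f) =
        eval x (dd ea f) + β x * eval x (dd eb f) + δ x * eval x (dd e3 f) := by
      simp [hv, dd_add, dd_smul]
    have e2 : eval x (dd (v x) (dd (v x) f)) = A x + 2 * β x * B x + β x ^ 2 * C x := by
      simp only [hv, dd_add, dd_smul, map_add, map_smul, smul_eval, hA, hB, hC, hδ, hg0, dd_comm e3 ea,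
        dd_comm eb ea, dd_comm e3 eb]
      ring
    have e4 : eval x (dd (v x) (dd eb f)) - c2 x * eval x (dd (v x) (dd e3 f)) =
        B x + β x * C x := by
      simp only [hv, dd_add, dd_smul, map_add, smul_eval, hB, hC, hδ, hg0, dd_comm e3 eb]
      ring
    refine ⟨?_, ?_, ?_⟩
    · rw [e1]
      simp only [hδ]
      linear_combination -hd1 - β x * hd2
    · rw [e2]
      linear_combination hβx + β x * hBC
    · have : eval x (dd e3 f) * eval x (dd (v x) (dd eb f)) -
          eval x (dd eb f) * eval x (dd (v x) (dd e3 f)) = eval x (dd e3 f) * S x := by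
        rw [← hBC, ← e4]
        linear_combination eval x (dd (v x) (dd e3 f)) * hd2
      rw [this]
      exact mul_ne_zero h3x hSx.ne'
  filter_upwards [key.eventually_nhds, hF.eventually_nhds, kβ.eventually (by simp),
    kδ.eventually (by simp)] with x hk hFx hβx hδx hfx
  refine line_subset_of_field hβx hδx hfx (congrFun hv) (hk.mono fun y hy => hy.1)
    (hk.mono fun y hy => hy.2.1) ?_ (hk.mono fun y hy => hy.2.2)
  filter_upwards [hk, hFx] with y hy hFy h0
  exact hFy h0 _ hy.1 hy.2.1

open Matrix

/-- The matrix with columns `a`, `b`, `c`. -/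
def colMat (a b c : Pt) : Matrix (Fin 3) (Fin 3) ℝ := Matrix.of fun i j => ![a, b, c] j i

lemma colMat_mulVec (a b c u : Pt) : colMat a b c *ᵥ u = u 0 • a + u 1 • b + u 2 • c := by
  ext i
  simp [colMat, Matrix.mulVec, dotProduct, Fin.sum_univ_three, mul_comm]

lemma det_colMat_ne_zero {a b c : Pt}
    (h : ∀ r s t : ℝ, r • a + s • b + t • c = 0 → r = 0 ∧ s = 0 ∧ t = 0) :
    (colMat a b c).det ≠ 0 := by
  intro h0
  obtain ⟨u, hu, hu0⟩ := Matrix.exists_mulVec_eq_zero_iff.2 h0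
  rw [colMat_mulVec] at hu0
  obtain ⟨h1, h2, h3⟩ := h _ _ _ hu0
  exact hu (by ext i; fin_cases i <;> simp [h1, h2, h3])

/-- The solution of a linear system by Cramer's rule. -/
noncomputable def cramerSol (M : Matrix (Fin 3) (Fin 3) ℝ) (y : Pt) : Pt :=
  M.det⁻¹ • (M.adjugate *ᵥ y)

lemma mulVec_cramerSol {M : Matrix (Fin 3) (Fin 3) ℝ} (hM : M.det ≠ 0) (y : Pt) :
    M *ᵥ cramerSol M y = y := by
  rw [cramerSol, Matrix.mulVec_smul, Matrix.mulVec_mulVec, Matrix.mul_adjugate, Matrix.smul_mulVec,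
    Matrix.one_mulVec, smul_smul, inv_mul_cancel₀ hM, one_smul]

lemma cramerSol_mulVec {M : Matrix (Fin 3) (Fin 3) ℝ} (hM : M.det ≠ 0) (u : Pt) :
    cramerSol M (M *ᵥ u) = u := by
  rw [cramerSol, Matrix.mulVec_mulVec, Matrix.adjugate_mul, Matrix.smul_mulVec,
    Matrix.one_mulVec, smul_smul, inv_mul_cancel₀ hM, one_smul]

lemma exists_coords {a b c : Pt}
    (h : ∀ r s t : ℝ, r • a + s • b + t • c = 0 → r = 0 ∧ s = 0 ∧ t = 0) (w : Pt) :
    ∃ r s t : ℝ, w = r • a + s • b + t • c := by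
  refine ⟨cramerSol (colMat a b c) w 0, cramerSol (colMat a b c) w 1,
    cramerSol (colMat a b c) w 2, ?_⟩
  rw [← colMat_mulVec, mulVec_cramerSol (det_colMat_ne_zero h)]

lemma exists_dd_dd_eq_zero {f : Poly} {x e v : Pt} {q r : ℝ} (he : line x e ⊆ zeroSet f)
    (hv : line x v ⊆ zeroSet f) (h : eval (x + q • e + r • v) f = 0) (hq : q ≠ 0) (hr : r ≠ 0) :
    ∃ τ ∈ Set.Ioo (0 : ℝ) 1, ∃ ρ ∈ Set.Ioo (0 : ℝ) 1,
      eval (x + (τ * q) • e + (ρ * r) • v) (dd e (dd v f)) = 0 := by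
  have hpath : ∀ (y u : Pt) (c t : ℝ), HasDerivAt (fun s : ℝ => y + (s * c) • u) (c • u) t := by
    intro y u c t
    simpa [smul_smul, mul_comm] using hasDerivAt_line y (c • u) t
  have hd1 : ∀ t : ℝ, HasDerivAt (fun s : ℝ => eval (x + r • v + (s * q) • e) f)
      (eval (x + r • v + (t * q) • e) (dd (q • e) f)) t :=
    fun t => hasDerivAt_eval (hpath _ _ _ _) f
  obtain ⟨τ, hτ, hτ0⟩ := exists_hasDerivAt_eq_zero zero_lt_one
    (fun t _ => (hd1 t).continuousAt.continuousWithinAt) (by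
      have h1 : eval (x + r • v) f = 0 := mem_zeroSet.1 (hv (mem_line x v r))
      have h2 : x + r • v + q • e = x + q • e + r • v := by abel
      simp [h1, h2, h]) (fun t _ => hd1 t)
  rw [dd_smul, smul_eval] at hτ0
  have hτ1 := (mul_eq_zero.1 hτ0).resolve_left hq
  have hd2 : ∀ t : ℝ, HasDerivAt (fun s : ℝ => eval (x + (τ * q) • e + (s * r) • v) (dd e f))
      (eval (x + (τ * q) • e + (t * r) • v) (dd (r • v) (dd e f))) t :=
    fun t => hasDerivAt_eval (hpath _ _ _ _) _
  obtain ⟨ρ, hρ, hρ0⟩ := exists_hasDerivAt_eq_zero zero_lt_one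
    (fun t _ => (hd2 t).continuousAt.continuousWithinAt) (by
      have h1 : eval (x + (τ * q) • e) (dd e f) = 0 :=
        mem_zeroSet.1 (line_subset_zeroSet_dd he (mem_line x e _))
      have h2 : x + (τ * q) • e + r • v = x + r • v + (τ * q) • e := by abel
      simp [h1, h2, hτ1]) (fun t _ => hd2 t)
  rw [dd_smul, smul_eval] at hρ0
  refine ⟨τ, hτ, ρ, hρ, ?_⟩
  rw [dd_comm]
  exact (mul_eq_zero.1 hρ0).resolve_left hr

lemma exists_ball_dd_dd_ne_zero {f : Poly} {p a b : Pt} (h : eval p (dd b (dd a f)) ≠ 0) :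
    ∃ ρ > 0, ∀ x v, dist x p < ρ → dist v a < ρ → eval x (dd b (dd v f)) ≠ 0 := by
  have hc : Continuous fun z : Pt × Pt => eval z.1 (dd b (dd z.2 f)) := by
    have : (fun z : Pt × Pt => eval z.1 (dd b (dd z.2 f))) =
        fun z => ∑ i, z.2 i * eval z.1 (dd b (pderiv i f)) := by
      funext z
      simp [dd_apply z.2]
    rw [this]
    refine continuous_finsetSum _ fun i _ => ?_
    exact ((continuous_apply i).comp continuous_snd).mul
      ((continuous_eval_poly _).comp continuous_fst)
  obtain ⟨ρ, hρ, hb⟩ := Metric.eventually_nhds_iff.1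
    (hc.continuousAt.eventually_ne (x := (p, a)) h)
  exact ⟨ρ, hρ, fun x v hx hv => hb (y := (x, v)) (max_lt hx hv)⟩

lemma eq_zero_of_smul_add_smul_eq_zero {f : Poly} {p ea eb : Pt}
    (haa : eval p (dd ea (dd ea f)) = 0) (hbb : eval p (dd eb (dd eb f)) = 0)
    (hab : eval p (dd eb (dd ea f)) ≠ 0) {r s : ℝ} (h : r • ea + s • eb = 0) :
    r = 0 ∧ s = 0 := by
  have hz : ∀ g, eval p (dd (r • ea + s • eb) g) = 0 := fun g => by rw [h]; simp [dd_apply]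
  have h1 := hz (dd ea f)
  have h2 := hz (dd eb f)
  simp only [dd_add, dd_smul, map_add, smul_eval, haa, hbb, mul_zero, zero_add, add_zero,
    dd_comm ea eb] at h1 h2
  exact ⟨(mul_eq_zero.1 h2).resolve_right hab, (mul_eq_zero.1 h1).resolve_right hab⟩

lemma eq_zero_of_combination_eq_zero {f : Poly} {p ea eb e3 : Pt}
    (ha : eval p (dd ea f) = 0) (hb : eval p (dd eb f) = 0) (h3 : eval p (dd e3 f) ≠ 0)
    (haa : eval p (dd ea (dd ea f)) = 0) (hbb : eval p (dd eb (dd eb f)) = 0)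
    (hab : eval p (dd eb (dd ea f)) ≠ 0) (r s t : ℝ) (h : r • ea + s • eb + t • e3 = 0) :
    r = 0 ∧ s = 0 ∧ t = 0 := by
  have hz : eval p (dd (r • ea + s • eb + t • e3) f) = 0 := by rw [h]; simp [dd_apply]
  simp only [dd_add, dd_smul, map_add, smul_eval, ha, hb, mul_zero, zero_add] at hz
  have ht := (mul_eq_zero.1 hz).resolve_right h3
  rw [ht, zero_smul, add_zero] at h
  obtain ⟨hr, hs⟩ := eq_zero_of_smul_add_smul_eq_zero haa hbb hab h
  exact ⟨hr, hs, ht⟩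

/-- Near a point where two lines of a surface cross transversally, nearby lines of the second
family leave the tangent plane. -/
lemma eventually_dd_ne_zero {f : Poly} {p ea eb e3 : Pt}
    (hla : line p ea ⊆ zeroSet f) (hlb : line p eb ⊆ zeroSet f)
    (h3 : eval p (dd e3 f) ≠ 0) (hab : eval p (dd eb (dd ea f)) ≠ 0) {vb : Pt → Pt}
    (hvb : ContinuousAt vb p) (hvb0 : vb p = eb)
    (hvbL : ∀ᶠ x in 𝓝 p, eval x f = 0 → line x (vb x) ⊆ zeroSet f) :
    ∀ᶠ s in 𝓝[≠] (0 : ℝ), line (p + s • ea) (vb (p + s • ea)) ⊆ zeroSet f ∧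
      eval p (dd (vb (p + s • ea)) f) ≠ 0 := by
  obtain ⟨-, ha1, ha2, -⟩ := line_jets hla
  obtain ⟨-, hb1, hb2, -⟩ := line_jets hlb
  obtain ⟨ρ, hρ, hball⟩ := exists_ball_dd_dd_ne_zero hab
  obtain ⟨ρ', hρ', hball'⟩ := exists_ball_dd_dd_ne_zero (by rwa [dd_comm] at hab)
  have hy : Tendsto (fun s : ℝ => p + s • ea) (𝓝 0) (𝓝 p) := by
    have : Continuous fun s : ℝ => p + s • ea := by fun_prop
    simpa using this.tendsto 0
  have hw : Tendsto (fun s : ℝ => vb (p + s • ea)) (𝓝 0) (𝓝 eb) := by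
    have := hvb.tendsto
    rw [hvb0] at this
    exact this.comp hy
  have hsmall : ∀ᶠ s : ℝ in 𝓝 0, |s| * ‖ea‖ < ρ := by
    have : Continuous fun s : ℝ => |s| * ‖ea‖ := by fun_prop
    exact this.tendsto' 0 0 (by simp) |>.eventually (gt_mem_nhds hρ)
  have hne : ∀ᶠ s : ℝ in 𝓝[≠] 0, s ≠ 0 := eventually_mem_nhdsWithin
  filter_upwards [hne, nhdsWithin_le_nhds (hy.eventually hvbL), nhdsWithin_le_nhds hsmall,
    nhdsWithin_le_nhds (hy.eventually (Metric.ball_mem_nhds p hρ')),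
    nhdsWithin_le_nhds (hw.eventually (Metric.ball_mem_nhds eb hρ'))] with s hs hL hsm hyb hwb
  have hys : eval (p + s • ea) f = 0 := mem_zeroSet.1 (hla (mem_line p ea s))
  have hL' := hL hys
  refine ⟨hL', fun h0 => ?_⟩
  obtain ⟨a, k, c, hakc⟩ := exists_coords
    (eq_zero_of_combination_eq_zero ha1 hb1 h3 ha2 hb2 hab) (vb (p + s • ea))
  have hc : c = 0 := by
    rw [hakc] at h0
    simp only [dd_add, dd_smul, map_add, smul_eval, ha1, hb1, mul_zero, zero_add] at h0
    exact (mul_eq_zero.1 h0).resolve_right h3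
  rw [hc, zero_smul, add_zero] at hakc
  have hk : k ≠ 0 := by
    intro hk
    rw [hk, zero_smul, add_zero] at hakc
    refine hball' _ _ hyb hwb ?_
    rw [hakc, dd_smul, map_smul, smul_eval]
    have : eval (p + s • ea) (dd ea (dd ea f)) = 0 := mem_zeroSet.1
      (line_subset_zeroSet_dd (line_subset_zeroSet_dd hla) (mem_line p ea s))
    rw [this, mul_zero]
  have hτ : ∀ᶠ τ : ℝ in 𝓝 0, |s + τ * a| * ‖ea‖ + |τ * k| * ‖eb‖ < ρ ∧ s + τ * a ≠ 0 := by
    have c1 : Continuous fun τ : ℝ => |s + τ * a| * ‖ea‖ + |τ * k| * ‖eb‖ := by fun_prop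
    have c2 : Continuous fun τ : ℝ => s + τ * a := by fun_prop
    exact (c1.tendsto' 0 (|s| * ‖ea‖) (by simp) |>.eventually (gt_mem_nhds hsm)).and
      (c2.continuousAt.eventually_ne (by simpa using hs))
  obtain ⟨τ, ⟨hτ1, hτ2⟩, hτ0⟩ :=
    ((hτ.filter_mono nhdsWithin_le_nhds).and
      (eventually_mem_nhdsWithin (s := {0}ᶜ) (a := (0 : ℝ)))).exists
  have hmem : eval (p + (τ * k) • eb + (s + τ * a) • ea) f = 0 := by
    have := mem_zeroSet.1 (hL' (mem_line _ _ τ))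
    rw [hakc] at this
    rwa [show p + (τ * k) • eb + (s + τ * a) • ea = p + s • ea + τ • (a • ea + k • eb) by module]
  obtain ⟨μ, hμ, ν, hν, h00⟩ := exists_dd_dd_eq_zero hlb hla hmem (mul_ne_zero hτ0 hk) hτ2
  refine hball _ _ ?_ (by simpa using hρ) h00
  have hle : ∀ {c : ℝ}, c ∈ Set.Ioo (0 : ℝ) 1 → ∀ d : ℝ, |c * d| ≤ |d| := by
    intro c hc d
    rw [abs_mul, abs_of_pos hc.1]
    exact mul_le_of_le_one_left (abs_nonneg _) hc.2.le
  have e : p + (μ * (τ * k)) • eb + (ν * (s + τ * a)) • ea - p =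
      (ν * (s + τ * a)) • ea + (μ * (τ * k)) • eb := by abel
  rw [dist_eq_norm, e]
  refine lt_of_le_of_lt (norm_add_le _ _) (lt_of_le_of_lt ?_ hτ1)
  rw [norm_smul, norm_smul, Real.norm_eq_abs, Real.norm_eq_abs]
  exact add_le_add (mul_le_mul_of_nonneg_right (hle hν _) (norm_nonneg _))
    (mul_le_mul_of_nonneg_right (hle hμ _) (norm_nonneg _))

/-- Nearby lines of the two rulings meet. -/
lemma eventually_exists_meeting {f : Poly} {p ea eb e3 : Pt}
    (hla : line p ea ⊆ zeroSet f) (hlb : line p eb ⊆ zeroSet f)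
    (h3 : eval p (dd e3 f) ≠ 0) (hab : eval p (dd eb (dd ea f)) ≠ 0) {va vb : Pt → Pt}
    (hva : ContinuousAt va p) (hva0 : va p = ea)
    (hvaL : ∀ᶠ x in 𝓝 p, eval x f = 0 → line x (va x) ⊆ zeroSet f)
    (hvb : ContinuousAt vb p) (hvb0 : vb p = eb)
    (hvbL : ∀ᶠ x in 𝓝 p, eval x f = 0 → line x (vb x) ⊆ zeroSet f) :
    ∀ᶠ s in 𝓝[≠] (0 : ℝ), line (p + s • ea) (vb (p + s • ea)) ⊆ zeroSet f ∧
      vb (p + s • ea) ≠ 0 ∧ ∃ r : ℝ → ℝ, Tendsto r (𝓝 0) (𝓝 s) ∧ ∀ᶠ t in 𝓝 (0 : ℝ),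
        p + t • eb + r t • va (p + t • eb) ∈ line (p + s • ea) (vb (p + s • ea)) := by
  obtain ⟨-, ha1, ha2, -⟩ := line_jets hla
  obtain ⟨-, hb1, hb2, -⟩ := line_jets hlb
  obtain ⟨ρ, hρ, hball⟩ := exists_ball_dd_dd_ne_zero hab
  have hsmall : ∀ᶠ s : ℝ in 𝓝 0, |s| * ‖ea‖ < ρ := by
    have : Continuous fun s : ℝ => |s| * ‖ea‖ := by fun_prop
    exact this.tendsto' 0 0 (by simp) |>.eventually (gt_mem_nhds hρ)
  have hx : Tendsto (fun t : ℝ => p + t • eb) (𝓝 0) (𝓝 p) := by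
    have : Continuous fun s : ℝ => p + s • eb := by fun_prop
    simpa using this.tendsto 0
  have hv : Tendsto (fun t : ℝ => va (p + t • eb)) (𝓝 0) (𝓝 ea) := by
    have := hva.tendsto
    rw [hva0] at this
    exact this.comp hx
  have hne : ∀ᶠ s : ℝ in 𝓝[≠] 0, s ≠ 0 := eventually_mem_nhdsWithin
  filter_upwards [eventually_dd_ne_zero hla hlb h3 hab hvb hvb0 hvbL, nhdsWithin_le_nhds hsmall,
    hne] with s ⟨hL, hw⟩ hsm hs
  generalize vb (p + s • ea) = w at hL hw ⊢
  refine ⟨hL, fun h => hw (by rw [h]; simp [dd_apply]), ?_⟩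
  have hdet : (colMat ea eb w).det ≠ 0 :=
    det_colMat_ne_zero (eq_zero_of_combination_eq_zero ha1 hb1 hw ha2 hb2 hab)
  obtain ⟨M, hM⟩ : ∃ M : ℝ → Matrix (Fin 3) (Fin 3) ℝ,
    M = fun t => colMat (va (p + t • eb)) eb w := ⟨_, rfl⟩
  have hMt : Tendsto M (𝓝 0) (𝓝 (colMat ea eb w)) := by
    rw [hM]
    refine tendsto_pi_nhds.2 fun i => tendsto_pi_nhds.2 fun j => ?_
    fin_cases j
    · exact (tendsto_pi_nhds.1 hv i)
    · exact tendsto_const_nhds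
    · exact tendsto_const_nhds
  obtain ⟨u, hu⟩ : ∃ u : ℝ → Pt, u = fun t => cramerSol (M t) (s • ea - t • eb) := ⟨_, rfl⟩
  have hut : Tendsto u (𝓝 0) (𝓝 ![s, 0, 0]) := by
    have h1 : cramerSol (colMat ea eb w) (s • ea) = ![s, 0, 0] := by
      have : s • ea = colMat ea eb w *ᵥ ![s, 0, 0] := by simp [colMat_mulVec]
      rw [this, cramerSol_mulVec hdet]
    have hcd : Tendsto (fun t => (M t).det) (𝓝 0) (𝓝 (colMat ea eb w).det) :=
      ((continuous_id.matrix_det).tendsto _).comp hMt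
    have hca : Tendsto (fun t => (M t).adjugate) (𝓝 0) (𝓝 (colMat ea eb w).adjugate) :=
      ((continuous_id.matrix_adjugate).tendsto _).comp hMt
    have hcy : Tendsto (fun t : ℝ => s • ea - t • eb) (𝓝 0) (𝓝 (s • ea)) := by
      have : Continuous fun t : ℝ => s • ea - t • eb := by fun_prop
      exact this.tendsto' _ _ (by simp)
    have hmv : Continuous fun z : Matrix (Fin 3) (Fin 3) ℝ × Pt => z.1 *ᵥ z.2 :=
      continuous_fst.matrix_mulVec continuous_snd
    rw [← h1, hu]
    exact (hcd.inv₀ hdet).smul ((hmv.tendsto _).comp (hca.prodMk_nhds hcy))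
  have hut' := tendsto_pi_nhds.1 hut
  have hu0 : Tendsto (fun t => u t 0) (𝓝 0) (𝓝 s) := by simpa using hut' 0
  have hu1 : Tendsto (fun t => u t 1) (𝓝 0) (𝓝 0) := by simpa using hut' 1
  refine ⟨fun t => u t 0, hu0, ?_⟩
  have hbd : ∀ᶠ t in 𝓝 (0 : ℝ),
      ‖t • eb‖ + |u t 1| * ‖eb‖ + |u t 0| * ‖va (p + t • eb)‖ < ρ := by
    have h1 : Tendsto (fun t : ℝ => ‖t • eb‖) (𝓝 0) (𝓝 0) := by
      have : Continuous fun t : ℝ => ‖t • eb‖ := by fun_prop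
      exact this.tendsto' _ _ (by simp)
    have := (h1.add (hu1.abs.mul_const ‖eb‖)).add (hu0.abs.mul hv.norm)
    exact this.eventually (gt_mem_nhds (by simpa using hsm))
  filter_upwards [hMt.eventually ((continuous_id.matrix_det).continuousAt.eventually_ne hdet),
    hbd, hu0.eventually (isOpen_ne.mem_nhds hs), hx.eventually hvaL,
    hv.eventually (Metric.ball_mem_nhds ea hρ)] with t hdt hbt hu0t hLt hvt
  have hsol : M t *ᵥ u t = s • ea - t • eb := by
    rw [hu]
    exact mulVec_cramerSol hdt _
  rw [hM, colMat_mulVec] at hsol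
  have hxt : eval (p + t • eb) f = 0 := mem_zeroSet.1 (hlb (mem_line p eb t))
  have hlb' : line (p + t • eb) eb ⊆ zeroSet f := by
    rwa [← line_eq_of_mem (mem_line p eb t)]
  have hpt : p + t • eb + u t 1 • eb + u t 0 • va (p + t • eb) =
      p + s • ea + (-(u t 2)) • w := by
    have : u t 0 • va (p + t • eb) = s • ea - t • eb - u t 1 • eb - u t 2 • w := by
      rw [← hsol]; abel
    rw [this]
    module
  have hq : u t 1 = 0 := by
    by_contra hq
    obtain ⟨μ, hμ, ν, hν, h00⟩ := exists_dd_dd_eq_zero hlb' (hLt hxt)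
      (by rw [hpt]; exact mem_zeroSet.1 (hL (mem_line _ _ _))) hq hu0t
    refine hball _ _ ?_ hvt h00
    have hle : ∀ {c : ℝ}, c ∈ Set.Ioo (0 : ℝ) 1 → ∀ d : ℝ, |c * d| ≤ |d| := by
      intro c hc d
      rw [abs_mul, abs_of_pos hc.1]
      exact mul_le_of_le_one_left (abs_nonneg _) hc.2.le
    have e : p + t • eb + (μ * u t 1) • eb + (ν * u t 0) • va (p + t • eb) - p =
        t • eb + (μ * u t 1) • eb + (ν * u t 0) • va (p + t • eb) := by abel
    rw [dist_eq_norm, e]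
    refine lt_of_le_of_lt ((norm_add_le _ _).trans (add_le_add_left (norm_add_le _ _) _))
      (lt_of_le_of_lt ?_ hbt)
    rw [norm_smul (μ * u t 1), norm_smul (ν * u t 0), Real.norm_eq_abs (μ * u t 1),
      Real.norm_eq_abs (ν * u t 0)]
    exact add_le_add (add_le_add le_rfl (mul_le_mul_of_nonneg_right (hle hμ _) (norm_nonneg _)))
      (mul_le_mul_of_nonneg_right (hle hν _) (norm_nonneg _))
  rw [hq, zero_smul, add_zero] at hpt
  rw [hpt]
  exact mem_line _ _ _

/-- An irreducible surface which is doubly ruled near a point is a quadric. -/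
theorem totalDegree_le_two_of_line_fields {f : Poly} (hf : Irreducible f) {p ea eb e3 : Pt}
    (hla : line p ea ⊆ zeroSet f) (hlb : line p eb ⊆ zeroSet f)
    (h3 : eval p (dd e3 f) ≠ 0) (hab : eval p (dd eb (dd ea f)) ≠ 0) {va vb : Pt → Pt}
    (hva : ContinuousAt va p) (hva0 : va p = ea)
    (hvaL : ∀ᶠ x in 𝓝 p, eval x f = 0 → line x (va x) ⊆ zeroSet f)
    (hvb : ContinuousAt vb p) (hvb0 : vb p = eb)
    (hvbL : ∀ᶠ x in 𝓝 p, eval x f = 0 → line x (vb x) ⊆ zeroSet f) :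
    f.totalDegree ≤ 2 := by
  obtain ⟨ε, hε, hmeet⟩ := Metric.eventually_nhds_iff.1 (eventually_nhdsWithin_iff.1
    (eventually_exists_meeting hla hlb h3 hab hva hva0 hvaL hvb hvb0 hvbL))
  have hmeet' : ∀ s : ℝ, 0 < s → s < ε → _ := fun s h0 h1 =>
    hmeet (y := s) (by simpa [abs_of_pos h0] using h1) h0.ne'
  obtain ⟨-, hw1, r1, hr1, hm1⟩ := hmeet' (ε / 2) (by positivity) (by linarith)
  obtain ⟨-, hw2, r2, hr2, hm2⟩ := hmeet' (ε / 3) (by positivity) (by linarith)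
  obtain ⟨-, hw3, r3, hr3, hm3⟩ := hmeet' (ε / 4) (by positivity) (by linarith)
  obtain ⟨Q, hQ0, hQd, hQ⟩ := exists_vanishing
    ({line (p + (ε / 2) • ea) (vb (p + (ε / 2) • ea)), line (p + (ε / 3) • ea)
      (vb (p + (ε / 3) • ea)), line (p + (ε / 4) • ea) (vb (p + (ε / 4) • ea))} : Finset (Set Pt))
    (by
      intro l hl
      simp only [Finset.mem_insert, Finset.mem_singleton] at hl
      rcases hl with rfl | rfl | rfl <;> apply isLine_line <;> assumption) 2
    (by
      refine lt_of_le_of_lt (Nat.mul_le_mul_left 6 Finset.card_le_three) (by norm_num))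
  simp only [Finset.mem_insert, Finset.mem_singleton, forall_eq_or_imp, forall_eq] at hQ
  obtain ⟨hQ1, hQ2, hQ3⟩ := hQ
  obtain ⟨ρ, hρ, hball⟩ := exists_ball_dd_dd_ne_zero hab
  have hx : Tendsto (fun t : ℝ => p + t • eb) (𝓝 0) (𝓝 p) := by
    have : Continuous fun s : ℝ => p + s • eb := by fun_prop
    simpa using this.tendsto 0
  have hv : Tendsto (fun t : ℝ => va (p + t • eb)) (𝓝 0) (𝓝 ea) := by
    have := hva.tendsto
    rw [hva0] at this
    exact this.comp hx
  have hne : ∀ {r r' : ℝ → ℝ} {s s' : ℝ}, Tendsto r (𝓝 0) (𝓝 s) → Tendsto r' (𝓝 0) (𝓝 s') →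
      s ≠ s' → ∀ᶠ t in 𝓝 (0 : ℝ), r t ≠ r' t := by
    intro r r' s s' h h' hss
    filter_upwards [(h.sub h').eventually (isOpen_ne.mem_nhds (sub_ne_zero.2 hss))] with t ht hrt
    exact ht (sub_eq_zero.2 hrt)
  have hgood : ∀ᶠ t in 𝓝 (0 : ℝ), eval (p + t • eb) (dd eb (dd (va (p + t • eb)) f)) ≠ 0 ∧
      line (p + t • eb) (va (p + t • eb)) ⊆ zeroSet f ∧
      line (p + t • eb) (va (p + t • eb)) ⊆ zeroSet Q := by
    filter_upwards [hm1, hm2, hm3, hne hr1 hr2 (by intro h; linarith),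
      hne hr1 hr3 (by intro h; linarith), hne hr2 hr3 (by intro h; linarith),
      hx.eventually hvaL, hx.eventually (Metric.ball_mem_nhds p hρ),
      hv.eventually (Metric.ball_mem_nhds ea hρ)] with t h1 h2 h3 h12 h13 h23 hL hxt hvt
    have hnz := hball _ _ hxt hvt
    refine ⟨hnz, hL (mem_zeroSet.1 (hlb (mem_line p eb t))), ?_⟩
    generalize hv' : va (p + t • eb) = v at *
    have hv0 : v ≠ 0 := by
      rintro rfl
      exact hnz (by simp [dd_apply 0])
    have hinj : ∀ {a b : ℝ}, a ≠ b → p + t • eb + a • v ≠ p + t • eb + b • v := by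
      intro a b hab h
      exact hab (smul_left_injective ℝ hv0 (add_left_cancel h))
    refine subset_zeroSet_of_card (isLine_line _ hv0)
      {p + t • eb + r1 t • v, p + t • eb + r2 t • v, p + t • eb + r3 t • v} ?_ ?_
    · intro x hx
      simp only [Finset.mem_insert, Finset.mem_singleton] at hx
      rcases hx with rfl | rfl | rfl
      · exact ⟨mem_line _ _ _, mem_zeroSet.1 (hQ1 h1)⟩
      · exact ⟨mem_line _ _ _, mem_zeroSet.1 (hQ2 h2)⟩
      · exact ⟨mem_line _ _ _, mem_zeroSet.1 (hQ3 h3)⟩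
    · rw [Finset.card_eq_three.2 ⟨_, _, _, hinj h12, hinj h13, hinj h23, rfl⟩]
      omega
  obtain ⟨η, hη, hgood⟩ := Metric.eventually_nhds_iff_ball.1 hgood
  have hdvd : f ∣ Q := by
    by_contra hdvd
    have hinf : (Metric.ball (0 : ℝ) η).Infinite := by
      rw [Real.ball_eq_Ioo]
      exact Set.Ioo_infinite (by linarith)
    obtain ⟨T, hT, hTc⟩ := hinf.exists_subset_card_eq (f.totalDegree * Q.totalDegree + 1)
    have hinj : Set.InjOn (fun t : ℝ => line (p + t • eb) (va (p + t • eb))) T := by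
      intro t ht t' ht' htt
      by_contra hne
      have hnz := (hgood t (hT ht)).1
      have hv0 : va (p + t • eb) ≠ 0 := by
        intro h
        rw [h] at hnz
        exact hnz (by simp [dd_apply 0])
      have heb : eb ≠ 0 := by
        rintro rfl
        exact hab (by simp [dd_apply 0])
      have heq : line (p + t • eb) (va (p + t • eb)) = line (p + t • eb) eb := by
        refine IsLine.eq_of_two_mem (isLine_line _ hv0) (isLine_line _ heb)
          (x := p + t • eb) (y := p + t' • eb) ?_ ⟨0, by simp⟩ ?_ ⟨0, by simp⟩ ⟨t' - t, by module⟩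
        · intro h
          exact hne (smul_left_injective ℝ heb (add_left_cancel h))
        · dsimp only at htt
          rw [htt]
          exact ⟨0, by simp⟩
      have hmem : p + t • eb + (1 : ℝ) • va (p + t • eb) ∈ line (p + t • eb) eb :=
        heq ▸ mem_line _ _ _
      obtain ⟨c, hc⟩ := hmem
      rw [one_smul] at hc
      rw [add_left_cancel hc, dd_smul, map_smul, smul_eval] at hnz
      refine hnz ?_
      have : eval (p + t • eb) (dd eb (dd eb f)) = 0 := mem_zeroSet.1
        (line_subset_zeroSet_dd (line_subset_zeroSet_dd hlb) (mem_line p eb t))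
      rw [this, mul_zero]
    have := card_common_lines_le hf hdvd
      (T.image fun t : ℝ => line (p + t • eb) (va (p + t • eb))) ?_ ?_ ?_
    · rw [Finset.card_image_of_injOn hinj, hTc] at this
      omega
    · intro l hl
      obtain ⟨t, ht, rfl⟩ := Finset.mem_image.1 hl
      refine isLine_line _ fun h => (hgood t (hT ht)).1 ?_
      rw [h]
      simp [dd_apply 0]
    · intro l hl
      obtain ⟨t, ht, rfl⟩ := Finset.mem_image.1 hl
      exact (hgood t (hT ht)).2.1
    · intro l hl
      obtain ⟨t, ht, rfl⟩ := Finset.mem_image.1 hl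
      exact (hgood t (hT ht)).2.2
  obtain ⟨R, rfl⟩ := hdvd
  have := totalDegree_mul_of_isDomain (left_ne_zero_of_mul hQ0) (right_ne_zero_of_mul hQ0)
  omega

/-- The second derivative of `f` along two polynomial vector fields, as a bilinear form. -/
noncomputable def hess (U V : Fin 3 → Poly) (f : Poly) : Poly :=
  ∑ j, ∑ i, U i * V j * pderiv i (pderiv j f)

/-- The third derivative of `f` along three polynomial vector fields, as a trilinear form. -/
noncomputable def cubic (U V W : Fin 3 → Poly) (f : Poly) : Poly :=
  ∑ k, ∑ j, ∑ i, U i * V j * W k * pderiv i (pderiv j (pderiv k f))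

lemma eval_hess (U V : Fin 3 → Poly) (f : Poly) (x : Pt) :
    eval x (hess U V f) =
      eval x (dd (fun i => eval x (U i)) (dd (fun i => eval x (V i)) f)) := by
  simp only [hess, dd_apply, map_sum, map_mul, smul_eval, Derivation.map_smul]
  exact Finset.sum_congr rfl fun i _ => Finset.sum_congr rfl fun j _ => by ring

lemma eval_cubic (U V W : Fin 3 → Poly) (f : Poly) (x : Pt) :
    eval x (cubic U V W f) = eval x (dd (fun i => eval x (U i)) (dd (fun i => eval x (V i))
      (dd (fun i => eval x (W i)) f))) := by
  simp only [cubic, dd_apply, map_sum, map_mul, smul_eval, Derivation.map_smul]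
  exact Finset.sum_congr rfl fun i _ => Finset.sum_congr rfl fun j _ =>
    Finset.sum_congr rfl fun k _ => by ring

lemma totalDegree_mul_le_of_le {f g : Poly} {m n : ℕ} (hf : f.totalDegree ≤ m)
    (hg : g.totalDegree ≤ n) : (f * g).totalDegree ≤ m + n :=
  (totalDegree_mul _ _).trans (add_le_add hf hg)

lemma totalDegree_C_mul_le (c : ℝ) (g : Poly) : (C c * g).totalDegree ≤ g.totalDegree := by
  simpa using totalDegree_mul (C c) g

lemma totalDegree_hess_le {U V : Fin 3 → Poly} {f : Poly} {D : ℕ} (hU : ∀ i, (U i).totalDegree ≤ D)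
    (hV : ∀ i, (V i).totalDegree ≤ D) (hf : f.totalDegree ≤ D) :
    (hess U V f).totalDegree ≤ D + D + D := by
  refine totalDegree_finsetSum_le fun j _ => totalDegree_finsetSum_le fun i _ => ?_
  refine totalDegree_mul_le_of_le (totalDegree_mul_le_of_le (hU i) (hV j)) ?_
  have h1 := totalDegree_pderiv_le i (pderiv j f)
  have h2 := totalDegree_pderiv_le j f
  omega

lemma totalDegree_cubic_le {U V W : Fin 3 → Poly} {f : Poly} {D : ℕ}
    (hU : ∀ i, (U i).totalDegree ≤ D) (hV : ∀ i, (V i).totalDegree ≤ D)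
    (hW : ∀ i, (W i).totalDegree ≤ D) (hf : f.totalDegree ≤ D) :
    (cubic U V W f).totalDegree ≤ D + D + D + D := by
  refine totalDegree_finsetSum_le fun k _ => totalDegree_finsetSum_le fun j _ =>
    totalDegree_finsetSum_le fun i _ => ?_
  refine totalDegree_mul_le_of_le
    (totalDegree_mul_le_of_le (totalDegree_mul_le_of_le (hU i) (hV j)) (hW k)) ?_
  have h1 := totalDegree_pderiv_le i (pderiv j (pderiv k f))
  have h2 := totalDegree_pderiv_le j (pderiv k f)
  have h3 := totalDegree_pderiv_le k f
  omega

/-- The field of tangent vectors to the level sets of `f` obtained from `e` by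
correcting along `e₃`. -/
noncomputable def tang (f : Poly) (e₃ e : Pt) : Fin 3 → Poly :=
  fun i => dd e₃ f * C (e i) - dd e f * C (e₃ i)

lemma eval_tang (f : Poly) (e₃ e x : Pt) :
    (fun i => eval x (tang f e₃ e i)) = eval x (dd e₃ f) • e - eval x (dd e f) • e₃ := by
  ext i
  simp [tang]

lemma totalDegree_tang_le (f : Poly) (e₃ e : Pt) (i : Fin 3) :
    (tang f e₃ e i).totalDegree ≤ f.totalDegree := by
  have h : ∀ (v : Pt) (c : ℝ), (dd v f * C c).totalDegree ≤ f.totalDegree := fun v c => by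
    have := totalDegree_mul_le_of_le (totalDegree_dd_le v f) (totalDegree_C (σ := Fin 3) c).le
    omega
  exact (totalDegree_sub _ _).trans (max_le (h _ _) (h _ _))

/-- The two coefficients of the remainder of the cubic form modulo the quadratic form
(up to the square of the leading coefficient of the latter). -/
noncomputable def remOne (U V : Fin 3 → Poly) (f : Poly) : Poly :=
  cubic U U U f * (C 4 * hess U V f ^ 2 - hess U U f * hess V V f) -
    C 6 * (hess U U f * hess U V f * cubic U U V f) + C 3 * (hess U U f ^ 2 * cubic U V V f)

/-- See `remOne`. -/
noncomputable def remZero (U V : Fin 3 → Poly) (f : Poly) : Poly :=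
  C 2 * (cubic U U U f * hess U V f * hess V V f) - C 3 * (hess U U f * cubic U U V f * hess V V f) +
    hess U U f ^ 2 * cubic V V V f

lemma totalDegree_remOne_le {U V : Fin 3 → Poly} {f : Poly}
    (hU : ∀ i, (U i).totalDegree ≤ f.totalDegree) (hV : ∀ i, (V i).totalDegree ≤ f.totalDegree) :
    (remOne U V f).totalDegree ≤ 10 * f.totalDegree := by
  have A := totalDegree_hess_le hU hU le_rfl
  have B := totalDegree_hess_le hU hV le_rfl
  have C' := totalDegree_hess_le hV hV le_rfl
  have a := totalDegree_cubic_le hU hU hU le_rfl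
  have b := totalDegree_cubic_le hU hU hV le_rfl
  have c := totalDegree_cubic_le hU hV hV le_rfl
  have B2 := totalDegree_pow (hess U V f) 2
  have A2 := totalDegree_pow (hess U U f) 2
  have k1 := totalDegree_C_mul_le 4 (hess U V f ^ 2)
  have k2 := totalDegree_C_mul_le 6 (hess U U f * hess U V f * cubic U U V f)
  have k3 := totalDegree_C_mul_le 3 (hess U U f ^ 2 * cubic U V V f)
  have m1 := totalDegree_mul (hess U U f) (hess V V f)
  have m2 := totalDegree_mul (hess U U f) (hess U V f)
  have m3 := totalDegree_mul (hess U U f * hess U V f) (cubic U U V f)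
  have m4 := totalDegree_mul (hess U U f ^ 2) (cubic U V V f)
  have m5 := totalDegree_sub (C 4 * hess U V f ^ 2) (hess U U f * hess V V f)
  have m6 := totalDegree_mul (cubic U U U f) (C 4 * hess U V f ^ 2 - hess U U f * hess V V f)
  refine (totalDegree_add _ _).trans (max_le ((totalDegree_sub _ _).trans (max_le ?_ ?_)) ?_) <;>
    omega

lemma totalDegree_remZero_le {U V : Fin 3 → Poly} {f : Poly}
    (hU : ∀ i, (U i).totalDegree ≤ f.totalDegree) (hV : ∀ i, (V i).totalDegree ≤ f.totalDegree) :
    (remZero U V f).totalDegree ≤ 10 * f.totalDegree := by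
  have A := totalDegree_hess_le hU hU le_rfl
  have B := totalDegree_hess_le hU hV le_rfl
  have C' := totalDegree_hess_le hV hV le_rfl
  have a := totalDegree_cubic_le hU hU hU le_rfl
  have b := totalDegree_cubic_le hU hU hV le_rfl
  have d := totalDegree_cubic_le hV hV hV le_rfl
  have A2 := totalDegree_pow (hess U U f) 2
  have k1 := totalDegree_C_mul_le 2 (cubic U U U f * hess U V f * hess V V f)
  have k2 := totalDegree_C_mul_le 3 (hess U U f * cubic U U V f * hess V V f)
  have m1 := totalDegree_mul (cubic U U U f) (hess U V f)
  have m2 := totalDegree_mul (cubic U U U f * hess U V f) (hess V V f)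
  have m3 := totalDegree_mul (hess U U f) (cubic U U V f)
  have m4 := totalDegree_mul (hess U U f * cubic U U V f) (hess V V f)
  have m5 := totalDegree_mul (hess U U f ^ 2) (cubic V V V f)
  refine (totalDegree_add _ _).trans (max_le ((totalDegree_sub _ _).trans (max_le ?_ ?_)) ?_) <;>
    omega

/-- If two independent asymptotic directions annihilate the cubic form, the remainder vanishes. -/
lemma eval_rem_eq_zero {U V : Fin 3 → Poly} {f : Poly} {x v w : Pt} {x₁ y₁ x₂ y₂ : ℝ}
    (hU : (fun i => eval x (U i)) = x₁ • v + y₁ • w)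
    (hV : (fun i => eval x (V i)) = x₂ • v + y₂ • w)
    (hv2 : eval x (dd v (dd v f)) = 0) (hw2 : eval x (dd w (dd w f)) = 0)
    (hv3 : eval x (dd v (dd v (dd v f))) = 0) (hw3 : eval x (dd w (dd w (dd w f))) = 0) :
    eval x (remOne U V f) = 0 ∧ eval x (remZero U V f) = 0 := by
  simp only [remOne, remZero, map_add, map_sub, map_mul, map_pow, eval_C, eval_hess, eval_cubic,
    hU, hV, dd_add, dd_smul, map_smul, smul_eval, dd_comm w v, hv2, hw2, hv3, hw3]
  constructor <;> ring

/-- If the remainder vanishes, asymptotic directions annihilate the cubic form. -/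
lemma cubic_eq_zero_of_rem {U V : Fin 3 → Poly} {f : Poly} {x q : Pt} {r s : ℝ}
    (hq : q = r • (fun i => eval x (U i)) + s • (fun i => eval x (V i)))
    (hA : eval x (hess U U f) ≠ 0) (h1 : eval x (remOne U V f) = 0)
    (h0 : eval x (remZero U V f) = 0) (h2 : eval x (dd q (dd q f)) = 0) :
    eval x (dd q (dd q (dd q f))) = 0 := by
  simp only [remOne, remZero, map_add, map_sub, map_mul, map_pow, eval_C, eval_hess,
    eval_cubic] at hA h1 h0
  generalize (fun i => eval x (U i)) = u at *
  generalize (fun i => eval x (V i)) = v at *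
  subst hq
  simp only [dd_add, dd_smul, map_add, map_smul, smul_eval, dd_comm v u] at h2 ⊢
  refine (mul_eq_zero.1 (?_ : eval x (dd u (dd u f)) ^ 2 * _ = 0)).resolve_left (pow_ne_zero 2 hA)
  linear_combination (r * s ^ 2) * h1 + s ^ 3 * h0 + (eval x (dd u (dd u f)) *
    eval x (dd u (dd u (dd u f))) * r + (3 * eval x (dd u (dd u (dd v f))) *
      eval x (dd u (dd u f)) - 2 * eval x (dd u (dd u (dd u f))) * eval x (dd u (dd v f))) * s) * h2

/-- If the mixed second derivative at `x` along two independent tangent directions vanishes,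
one of them being asymptotic, then the derivative of the tangent plane along the latter vanishes. -/
lemma wronskian_eq_zero {f : Poly} {x v w e₃ : Pt} (hv : eval x (dd v f) = 0)
    (hw : eval x (dd w f) = 0) (h3 : eval x (dd e₃ f) ≠ 0) (hvv : eval x (dd v (dd v f)) = 0)
    (hvw : eval x (dd v (dd w f)) = 0) (hind : ∀ r s : ℝ, r • v + s • w = 0 → r = 0 ∧ s = 0)
    (e : Pt) :
    eval x (dd e₃ f * dd v (dd e f) - dd e f * dd v (dd e₃ f)) = 0 := by
  obtain ⟨r, s, t, rfl⟩ := exists_coords (a := v) (b := w) (c := e₃) (fun r s t h => by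
    have hz : eval x (dd (r • v + s • w + t • e₃) f) = 0 := by rw [h]; simp [dd_apply]
    simp only [dd_add, dd_smul, map_add, smul_eval, hv, hw, mul_zero, zero_add] at hz
    have ht := (mul_eq_zero.1 hz).resolve_right h3
    rw [ht, zero_smul, add_zero] at h
    exact ⟨(hind r s h).1, (hind r s h).2, ht⟩) e
  simp only [dd_add, dd_smul, map_add, map_sub, map_mul, map_smul, smul_eval, hv, hw, hvv, hvw]
  ring

lemma smul_add_smul_eq_zero_of_line_ne {x v w : Pt} (hv : v ≠ 0) (hw : w ≠ 0)
    (hne : line x w ≠ line x v) (r s : ℝ) (h : r • v + s • w = 0) : r = 0 ∧ s = 0 := by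
  rcases eq_or_ne s 0 with rfl | hs
  · simpa [hv] using h
  · have hws : w = (-r / s) • v := by
      have : s • w = (-r) • v := by rw [neg_smul]; exact (neg_eq_of_add_eq_zero_right h).symm
      rw [div_eq_inv_mul, mul_smul, ← this, smul_smul, inv_mul_cancel₀ hs, one_smul]
    have hc : -r / s ≠ 0 := by
      intro h0
      rw [h0, zero_smul] at hws
      exact hw hws
    exact absurd (by rw [hws, line_smul _ _ hc]) hne

/-- Two univariate polynomials with vanishing Wronskian are proportional. -/
lemma exists_eq_C_mul_of_wronskian {a b : Polynomial ℝ} (hb : b ≠ 0)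
    (h : a.derivative * b = a * b.derivative) : ∃ c : ℝ, a = Polynomial.C c * b := by
  obtain ⟨t, ht⟩ : ∃ t, b.eval t ≠ 0 := by
    by_contra! h0
    exact hb (Polynomial.funext fun t => by simpa using h0 t)
  refine ⟨a.eval t / b.eval t, ?_⟩
  obtain ⟨g, hg⟩ : ∃ g, g = a - Polynomial.C (a.eval t / b.eval t) * b := ⟨_, rfl⟩
  rw [← sub_eq_zero, ← hg]
  have hroot : g.IsRoot t := by
    rw [Polynomial.IsRoot, hg]
    simp [ht]
  have hW : g.derivative * b = g * b.derivative := by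
    rw [hg]
    simp only [Polynomial.derivative_sub, Polynomial.derivative_C_mul]
    linear_combination h
  by_contra hg0
  have hpos := (Polynomial.rootMultiplicity_pos hg0).2 hroot
  have hdvd : (Polynomial.X - Polynomial.C t) ^ g.rootMultiplicity t ∣ g.derivative := by
    refine IsCoprime.dvd_of_dvd_mul_right (z := b) ?_ ?_
    · refine IsCoprime.pow_left ((Polynomial.irreducible_X_sub_C t).coprime_iff_not_dvd.2 ?_)
      rwa [Polynomial.dvd_iff_isRoot]
    · rw [hW]
      exact (Polynomial.pow_rootMultiplicity_dvd g t).mul_right _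
  have hder : g.derivative ≠ 0 := by
    intro h0
    have hC := Polynomial.eq_C_of_derivative_eq_zero h0
    rw [hC] at hroot
    have h1 : g.coeff 0 = 0 := by simpa using hroot
    rw [h1, map_zero] at hC
    exact hg0 hC
  have h1 := (Polynomial.le_rootMultiplicity_iff hder).2 hdvd
  rw [Polynomial.derivative_rootMultiplicity_of_root hroot] at h1
  omega

lemma derivative_restr (p v : Pt) (f : Poly) :
    (restr p v f).derivative = restr p v (dd v f) := by
  refine Polynomial.funext fun t => ?_
  have h1 := hasDerivAt_eval (hasDerivAt_line p v t) f
  simp only [← eval_restr] at h1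
  exact ((restr p v f).hasDerivAt t).unique h1

/-- If the tangent plane does not turn along a line, it is constant along the line. -/
lemma gradient_proportional {f : Poly} {p v e₃ e : Pt} (h3 : ¬ line p v ⊆ zeroSet (dd e₃ f))
    (h : line p v ⊆ zeroSet (dd e₃ f * dd v (dd e f) - dd e f * dd v (dd e₃ f))) :
    ∃ c : ℝ, ∀ x ∈ line p v, eval x (dd e f) = c * eval x (dd e₃ f) := by
  rw [← restr_eq_zero_iff] at h h3
  obtain ⟨c, hc⟩ := exists_eq_C_mul_of_wronskian (a := restr p v (dd e f)) h3 (by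
    rw [derivative_restr, derivative_restr]
    rw [map_sub, map_mul, map_mul] at h
    linear_combination h)
  refine ⟨c, ?_⟩
  rintro _ ⟨t, rfl⟩
  rw [← eval_restr, ← eval_restr, hc]
  simp

/-- The affine form defining the tangent plane at `x₀` of the level set of `f`. -/
noncomputable def tangentForm (f : Poly) (x₀ : Pt) : Poly :=
  ∑ i, C (eval x₀ (pderiv i f)) * (X i - C (x₀ i))

lemma eval_tangentForm (f : Poly) (x₀ y : Pt) :
    eval y (tangentForm f x₀) = eval x₀ (dd (y - x₀) f) := by
  simp only [tangentForm, dd_apply, map_sum, map_mul, map_sub, eval_C, eval_X, smul_eval,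
    Pi.sub_apply]
  exact Finset.sum_congr rfl fun i _ => by ring

lemma totalDegree_tangentForm_le (f : Poly) (x₀ : Pt) : (tangentForm f x₀).totalDegree ≤ 1 := by
  refine totalDegree_finsetSum_le fun i _ => (totalDegree_C_mul_le _ _).trans ?_
  refine (totalDegree_sub _ _).trans (max_le (totalDegree_X i).le ?_)
  simp

lemma not_dvd_of_totalDegree_lt {f g : Poly} (hg : g ≠ 0) (h : g.totalDegree < f.totalDegree) :
    ¬ f ∣ g := by
  rintro ⟨k, rfl⟩
  have hk := right_ne_zero_of_mul hg
  have hf := left_ne_zero_of_mul hg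
  rw [totalDegree_mul_of_isDomain hf hk] at h
  omega

/-- A point of a surface lying on a second line of the surface. -/
def IsCrossing (f : Poly) (l : Set Pt) (x : Pt) : Prop :=
  x ∈ l ∧ ∃ m, IsLine m ∧ m ≠ l ∧ x ∈ m ∧ m ⊆ zeroSet f

/-- Most of the crossings on a line are transversal with nondegenerate mixed derivative. -/
lemma exists_good_crossings {f : Poly} (hf : Irreducible f) (hD : 2 ≤ f.totalDegree)
    {p v e₃ : Pt} (hv : v ≠ 0) (hl : line p v ⊆ zeroSet f)
    (h3 : ¬ line p v ⊆ zeroSet (dd e₃ f)) (T : Finset Pt) (hT : 13 * f.totalDegree < T.card)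
    (hTc : ∀ x ∈ T, IsCrossing f (line p v) x) :
    ∃ G ⊆ T, 10 * f.totalDegree < G.card ∧ ∀ x ∈ G, eval x (dd e₃ f) ≠ 0 ∧
      ∃ w, line x w ⊆ zeroSet f ∧ eval x (dd v (dd w f)) ≠ 0 := by
  obtain ⟨hfin3, hcard3⟩ := finite_inter_zeroSet (isLine_line p hv) h3
  have hdeg3 := totalDegree_dd_le e₃ f
  by_cases hW : ∃ e, ¬ line p v ⊆ zeroSet (dd e₃ f * dd v (dd e f) - dd e f * dd v (dd e₃ f))
  · obtain ⟨e, he⟩ := hW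
    obtain ⟨hfinW, hcardW⟩ := finite_inter_zeroSet (isLine_line p hv) he
    have hdegW : (dd e₃ f * dd v (dd e f) - dd e f * dd v (dd e₃ f)).totalDegree ≤
        f.totalDegree + f.totalDegree := by
      have h1 : ∀ a b : Pt, (dd a f * dd v (dd b f)).totalDegree ≤
          f.totalDegree + f.totalDegree := fun a b => by
        have k1 := totalDegree_dd_le a f
        have k2 := totalDegree_dd_le b f
        have k3 := totalDegree_dd_le v (dd b f)
        exact totalDegree_mul_le_of_le (by omega) (by omega)
      exact (totalDegree_sub _ _).trans (max_le (h1 _ _) (h1 _ _))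
    obtain ⟨G, hG⟩ : ∃ G, G = T.filter fun x => eval x (dd e₃ f) ≠ 0 ∧
      eval x (dd e₃ f * dd v (dd e f) - dd e f * dd v (dd e₃ f)) ≠ 0 := ⟨_, rfl⟩
    refine ⟨G, hG ▸ Finset.filter_subset _ _, ?_, ?_⟩
    · have hsub : T ⊆ G ∪ (hfin3.toFinset ∪ hfinW.toFinset) := by
        intro x hx
        have hxl := (hTc x hx).1
        simp only [hG, Finset.mem_union, Finset.mem_filter, Set.Finite.mem_toFinset,
          Set.mem_inter_iff, mem_zeroSet]
        tauto
      have h1 := Finset.card_le_card hsub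
      have h2 := Finset.card_union_le G (hfin3.toFinset ∪ hfinW.toFinset)
      have h4 := Finset.card_union_le hfin3.toFinset hfinW.toFinset
      rw [Set.ncard_eq_toFinset_card _ hfin3] at hcard3
      rw [Set.ncard_eq_toFinset_card _ hfinW] at hcardW
      omega
    · intro x hx
      rw [hG] at hx
      obtain ⟨hxT, hx3, hxW⟩ := Finset.mem_filter.1 hx
      obtain ⟨hxl, m, hm, hml, hxm, hmf⟩ := hTc x hxT
      obtain ⟨w, hw, rfl⟩ := hm.exists_eq_line hxm
      rw [line_eq_of_mem hxl] at hl hml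
      refine ⟨hx3, w, hmf, fun h0 => hxW ?_⟩
      exact wronskian_eq_zero (line_jets hl).2.1 (line_jets hmf).2.1 hx3 (line_jets hl).2.2.1 h0
        (smul_add_smul_eq_zero_of_line_ne hv hw hml) e
  · exfalso
    push Not at hW
    obtain ⟨x₀, hx₀, hx₀3⟩ := Set.not_subset.1 h3
    rw [mem_zeroSet] at hx₀3
    have hform : ∀ x ∈ line p v, eval x (dd e₃ f) ≠ 0 → ∀ e, eval x (dd e f) = 0 →
        eval x₀ (dd e f) = 0 := by
      intro x hx hx3 e he
      obtain ⟨c, hc⟩ := gradient_proportional h3 (hW e)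
      have := hc x hx
      rw [he, eq_comm, mul_eq_zero] at this
      rw [hc x₀ hx₀, this.resolve_right hx3, zero_mul]
    have hg0 : tangentForm f x₀ ≠ 0 := by
      intro h0
      have := eval_tangentForm f x₀ (x₀ + e₃)
      rw [h0, map_zero, add_sub_cancel_left] at this
      exact hx₀3 this.symm
    have hgdeg := totalDegree_tangentForm_le f x₀
    choose! M hM using fun x hx => (hTc x hx).2
    obtain ⟨G, hG⟩ : ∃ G, G = T.filter fun x => eval x (dd e₃ f) ≠ 0 := ⟨_, rfl⟩
    have hGT : ∀ x ∈ G, x ∈ T ∧ eval x (dd e₃ f) ≠ 0 := fun x hx => by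
      rw [hG] at hx
      exact Finset.mem_filter.1 hx
    have hinj : Set.InjOn M G := by
      intro x hx y hy hxy
      by_contra hne
      obtain ⟨h1, h2, h4, -⟩ := hM x (hGT x hx).1
      obtain ⟨-, -, h5, -⟩ := hM y (hGT y hy).1
      rw [← hxy] at h5
      exact h2 (h1.eq_of_two_mem (isLine_line p hv) hne h4 h5 (hTc x (hGT x hx).1).1
        (hTc y (hGT y hy).1).1)
    have hcard := card_common_lines_le hf (not_dvd_of_totalDegree_lt hg0 (by omega)) (G.image M)
      (fun l hl' => by
        obtain ⟨x, hx, rfl⟩ := Finset.mem_image.1 hl'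
        exact (hM x (hGT x hx).1).1)
      (fun l hl' => by
        obtain ⟨x, hx, rfl⟩ := Finset.mem_image.1 hl'
        exact (hM x (hGT x hx).1).2.2.2)
      (fun l hl' => by
        obtain ⟨x, hx, rfl⟩ := Finset.mem_image.1 hl'
        obtain ⟨hxT, hx3⟩ := hGT x hx
        obtain ⟨h1, -, h4, h5⟩ := hM x hxT
        obtain ⟨w, hw, hmw⟩ := h1.exists_eq_line h4
        rw [hmw] at h5 ⊢
        have hxl := (hTc x hxT).1
        have hw0 := hform x hxl hx3 w (line_jets h5).2.1
        have hlx := hl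
        rw [line_eq_of_mem hxl] at hlx
        have hv0 := hform x hxl hx3 v (line_jets hlx).2.1
        rintro _ ⟨t, rfl⟩
        rw [line_eq_of_mem hx₀] at hxl
        obtain ⟨r, rfl⟩ := hxl
        rw [mem_zeroSet, eval_tangentForm,
          show x₀ + r • v + t • w - x₀ = r • v + t • w by abel]
        simp [dd_add, dd_smul, hv0, hw0])
    rw [Finset.card_image_of_injOn hinj] at hcard
    have hsub : T ⊆ G ∪ hfin3.toFinset := by
      intro x hx
      have hxl := (hTc x hx).1
      rw [hG]
      simp only [Finset.mem_union, Finset.mem_filter, Set.Finite.mem_toFinset, Set.mem_inter_iff,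
        mem_zeroSet]
      tauto
    have h1 := Finset.card_le_card hsub
    have h2 := Finset.card_union_le G hfin3.toFinset
    rw [Set.ncard_eq_toFinset_card _ hfin3] at hcard3
    have h4 : f.totalDegree * (tangentForm f x₀).totalDegree ≤ f.totalDegree * 1 :=
      Nat.mul_le_mul_left _ hgdeg
    omega

/-- At a nondegenerate crossing the remainders vanish. -/
lemma eval_rem_tang_eq_zero {f : Poly} {x v w e₃ : Pt} (hv : line x v ⊆ zeroSet f)
    (hw : line x w ⊆ zeroSet f) (h3 : eval x (dd e₃ f) ≠ 0) (hvw : eval x (dd w (dd v f)) ≠ 0)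
    (e₁ e₂ : Pt) :
    eval x (remOne (tang f e₃ e₁) (tang f e₃ e₂) f) = 0 ∧
      eval x (remZero (tang f e₃ e₁) (tang f e₃ e₂) f) = 0 := by
  obtain ⟨-, hv1, hv2, hv3⟩ := line_jets hv
  obtain ⟨-, hw1, hw2, hw3⟩ := line_jets hw
  have key : ∀ e, ∃ r s : ℝ, (fun i => eval x (tang f e₃ e i)) = r • v + s • w := by
    intro e
    obtain ⟨r, s, t, rfl⟩ :=
      exists_coords (eq_zero_of_combination_eq_zero hv1 hw1 h3 hv2 hw2 hvw) e
    refine ⟨eval x (dd e₃ f) * r, eval x (dd e₃ f) * s, ?_⟩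
    rw [eval_tang]
    simp only [dd_add, dd_smul, map_add, smul_eval, hv1, hw1]
    module
  obtain ⟨r₁, s₁, h1⟩ := key e₁
  obtain ⟨r₂, s₂, h2⟩ := key e₂
  exact eval_rem_eq_zero h1 h2 hv2 hw2 hv3 hw3

/-- `exists_line_field` without a sign condition on the mixed derivative. -/
lemma exists_line_field_of_ne_zero {f : Poly} {p ea eb e₃ : Pt} (ha : eval p (dd ea f) = 0)
    (hb : eval p (dd eb f) = 0) (h3 : eval p (dd e₃ f) ≠ 0) (haa : eval p (dd ea (dd ea f)) = 0)
    (hab : eval p (dd ea (dd eb f)) ≠ 0)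
    (hF : ∀ᶠ x in 𝓝 p, eval x f = 0 → ∀ v, eval x (dd v f) = 0 → eval x (dd v (dd v f)) = 0 →
      eval x (dd v (dd v (dd v f))) = 0) :
    ∃ v : Pt → Pt, ContinuousAt v p ∧ v p = ea ∧
      ∀ᶠ x in 𝓝 p, eval x f = 0 → line x (v x) ⊆ zeroSet f := by
  rcases lt_or_gt_of_ne hab with h | h
  · exact exists_line_field (eb := -eb) ha (by simp [dd_neg, hb]) h3 haa
      (by simpa [dd_neg] using h) hF
  · exact exists_line_field ha hb h3 haa h hF

/-- If a factor divides all remainders, asymptotic directions annihilate the cubic form. -/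
lemma eventually_cubic_eq_zero {f : Poly} {p ea eb e₃ : Pt} (hla : line p ea ⊆ zeroSet f)
    (hlb : line p eb ⊆ zeroSet f) (h3 : eval p (dd e₃ f) ≠ 0)
    (hab : eval p (dd eb (dd ea f)) ≠ 0)
    (h1 : ∀ e₁ e₂, f ∣ remOne (tang f e₃ e₁) (tang f e₃ e₂) f)
    (h0 : ∀ e₁ e₂, f ∣ remZero (tang f e₃ e₁) (tang f e₃ e₂) f) :
    ∀ᶠ x in 𝓝 p, eval x f = 0 → ∀ v, eval x (dd v f) = 0 → eval x (dd v (dd v f)) = 0 →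
      eval x (dd v (dd v (dd v f))) = 0 := by
  obtain ⟨-, ha1, ha2, -⟩ := line_jets hla
  obtain ⟨-, hb1, hb2, -⟩ := line_jets hlb
  have hA : eval p (hess (tang f e₃ (ea + eb)) (tang f e₃ (ea + eb)) f) ≠ 0 := by
    rw [eval_hess, eval_tang]
    simp only [dd_add, dd_sub, dd_smul, map_add, map_smul, map_sub, smul_eval, ha1, ha2, hb1, hb2,
      dd_comm ea eb, zero_mul, add_zero, zero_add, sub_zero]
    rw [← mul_add, ← two_mul]
    exact mul_ne_zero h3 (mul_ne_zero h3 (mul_ne_zero two_ne_zero hab))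
  filter_upwards [(continuous_eval_poly _).continuousAt.eventually_ne hA,
    (continuous_eval_poly _).continuousAt.eventually_ne h3] with x hxA hx3 hxf v hv1 hv2
  have hdvd : ∀ g, f ∣ g → eval x g = 0 := by
    rintro _ ⟨k, rfl⟩
    rw [map_mul, hxf, zero_mul]
  obtain ⟨r, s, t, hrst⟩ :=
    exists_coords (eq_zero_of_combination_eq_zero ha1 hb1 h3 ha2 hb2 hab) v
  refine cubic_eq_zero_of_rem (U := tang f e₃ (ea + eb)) (V := tang f e₃ eb)
    (r := r / eval x (dd e₃ f)) (s := (s - r) / eval x (dd e₃ f)) ?_ hxA (hdvd _ (h1 _ _))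
    (hdvd _ (h0 _ _)) hv2
  rw [eval_tang, eval_tang]
  rw [hrst] at hv1 ⊢
  simp only [dd_add, dd_smul, map_add, smul_eval] at hv1 ⊢
  ext i
  simp only [Pi.add_apply, Pi.smul_apply, Pi.sub_apply, smul_eq_mul]
  field_simp
  linear_combination (e₃ i) * hv1

/-- An irreducible surface of degree at least three contains few lines with many crossings. -/
theorem card_rich_lines_le {f : Poly} (hf : Irreducible f) (hD : 3 ≤ f.totalDegree)
    (S : Finset (Set Pt)) (hS : ∀ l ∈ S, IsLine l) (hSf : ∀ l ∈ S, l ⊆ zeroSet f)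
    (hT : ∀ l ∈ S, ∃ T : Finset Pt, 13 * f.totalDegree < T.card ∧ ∀ x ∈ T, IsCrossing f l x) :
    S.card ≤ 11 * f.totalDegree ^ 2 := by
  by_contra! hlt
  obtain ⟨i, hi⟩ := exists_pderiv_ne_zero hf
  obtain ⟨e₃, he₃⟩ : ∃ e₃ : Pt, e₃ = Pi.single i 1 := ⟨_, rfl⟩
  have hdd : dd e₃ f = pderiv i f := by
    rw [dd_apply, he₃, Finset.sum_eq_single i]
    · simp
    · intro j _ hj
      simp [hj]
    · simp
  have hdeg := totalDegree_dd_le e₃ f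
  have hcard0 := card_common_lines_le hf
    (not_dvd_of_totalDegree_lt (g := dd e₃ f) (by rwa [hdd]) (by omega))
    (S.filter fun l => l ⊆ zeroSet (dd e₃ f)) (fun l hl => hS l (Finset.mem_filter.1 hl).1)
    (fun l hl => hSf l (Finset.mem_filter.1 hl).1) (fun l hl => (Finset.mem_filter.1 hl).2)
  have hsplit := Finset.card_filter_add_card_filter_not (s := S) (fun l => l ⊆ zeroSet (dd e₃ f))
  obtain ⟨S₁, hS₁⟩ : ∃ S₁, S₁ = S.filter fun l => ¬ l ⊆ zeroSet (dd e₃ f) := ⟨_, rfl⟩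
  rw [← hS₁] at hsplit
  have hmem : ∀ l ∈ S₁, l ∈ S ∧ ¬ l ⊆ zeroSet (dd e₃ f) := fun l hl => by
    rw [hS₁] at hl
    exact Finset.mem_filter.1 hl
  have hcard1 : f.totalDegree * (10 * f.totalDegree) < S₁.card := by
    have h1 : f.totalDegree * (dd e₃ f).totalDegree ≤ f.totalDegree * f.totalDegree :=
      Nat.mul_le_mul_left _ (by omega)
    nlinarith
  have hgood : ∀ l ∈ S₁, ∃ G : Finset Pt, 10 * f.totalDegree < G.card ∧ ∀ x ∈ G,
      x ∈ l ∧ eval x (dd e₃ f) ≠ 0 ∧ ∃ v w, line x v ⊆ zeroSet f ∧ line x w ⊆ zeroSet f ∧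
        eval x (dd w (dd v f)) ≠ 0 := by
    intro l hl
    obtain ⟨hlS, hl3⟩ := hmem l hl
    obtain ⟨T, hTcard, hTc⟩ := hT l hlS
    have hlf := hSf l hlS
    obtain ⟨p, v, hv, hpv⟩ := hS l hlS
    replace hpv : l = line p v := hpv
    subst hpv
    obtain ⟨G, hGT, hGcard, hG⟩ := exists_good_crossings hf (by omega) hv hlf hl3 T hTcard hTc
    refine ⟨G, hGcard, fun x hx => ?_⟩
    obtain ⟨h3, w, hw, hvw⟩ := hG x hx
    have hxl := (hTc x (hGT hx)).1
    refine ⟨hxl, h3, v, w, ?_, hw, by rwa [dd_comm]⟩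
    rwa [← line_eq_of_mem hxl]
  have hdvd : ∀ g : Poly, g.totalDegree ≤ 10 * f.totalDegree →
      (∀ x v w, line x v ⊆ zeroSet f → line x w ⊆ zeroSet f → eval x (dd e₃ f) ≠ 0 →
        eval x (dd w (dd v f)) ≠ 0 → eval x g = 0) → f ∣ g := by
    intro g hg hx
    by_contra hfg
    refine absurd (card_common_lines_le hf hfg S₁ (fun l hl => hS l (hmem l hl).1)
      (fun l hl => hSf l (hmem l hl).1) fun l hl => ?_) (not_le.2 (lt_of_le_of_lt ?_ hcard1))
    · obtain ⟨G, hGcard, hG⟩ := hgood l hl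
      refine subset_zeroSet_of_card (hS l (hmem l hl).1) G (fun x hxG => ?_) (hg.trans_lt hGcard)
      obtain ⟨hxl, h3, v, w, hv, hw, hvw⟩ := hG x hxG
      exact ⟨hxl, hx x v w hv hw h3 hvw⟩
    · exact Nat.mul_le_mul_left _ hg
  obtain ⟨l, hl⟩ : S₁.Nonempty := Finset.card_pos.1 (by omega)
  obtain ⟨G, hGcard, hG⟩ := hgood l hl
  obtain ⟨p, hp⟩ : G.Nonempty := Finset.card_pos.1 (by omega)
  obtain ⟨-, h3, ea, eb, hla, hlb, hab⟩ := hG p hp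
  have hF := eventually_cubic_eq_zero hla hlb h3 hab
    (fun e₁ e₂ => hdvd _
      (totalDegree_remOne_le (totalDegree_tang_le f e₃ e₁) (totalDegree_tang_le f e₃ e₂))
      fun x v w hv hw h3 hvw => (eval_rem_tang_eq_zero hv hw h3 hvw e₁ e₂).1)
    (fun e₁ e₂ => hdvd _
      (totalDegree_remZero_le (totalDegree_tang_le f e₃ e₁) (totalDegree_tang_le f e₃ e₂))
      fun x v w hv hw h3 hvw => (eval_rem_tang_eq_zero hv hw h3 hvw e₁ e₂).2)
  obtain ⟨-, ha1, ha2, -⟩ := line_jets hla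
  obtain ⟨-, hb1, hb2, -⟩ := line_jets hlb
  obtain ⟨va, hva, hva0, hvaL⟩ :=
    exists_line_field_of_ne_zero ha1 hb1 h3 ha2 (by rwa [dd_comm]) hF
  obtain ⟨vb, hvb, hvb0, hvbL⟩ := exists_line_field_of_ne_zero hb1 ha1 h3 hb2 hab hF
  have := totalDegree_le_two_of_line_fields hf hla hlb h3 hab hva hva0 hvaL hvb hvb0 hvbL
  omega

/-- A common point of two sets, if there is one. -/
noncomputable def meet (l m : Set Pt) : Pt := if h : (l ∩ m).Nonempty then h.some else 0

lemma meet_mem {l m : Set Pt} (h : (l ∩ m).Nonempty) : meet l m ∈ l ∩ m := by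
  rw [meet, dif_pos h]
  exact h.some_mem

lemma meet_eq {l m : Set Pt} (hl : IsLine l) (hm : IsLine m) (hne : l ≠ m) {x : Pt} (hxl : x ∈ l)
    (hxm : x ∈ m) : meet l m = x := by
  have h := meet_mem ⟨x, hxl, hxm⟩
  by_contra hx
  exact hne (hl.eq_of_two_mem hm hx h.1 hxl h.2 hxm)

/-- The points of `m` on other lines of `L`. -/
noncomputable def hits (L : Finset (Set Pt)) (m : Set Pt) : Finset Pt :=
  (L.filter fun l => l ≠ m ∧ (l ∩ m).Nonempty).image fun l => meet l m

lemma card_hits_le (L : Finset (Set Pt)) (m : Set Pt) : (hits L m).card ≤ L.card :=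
  Finset.card_image_le.trans (Finset.card_filter_le _ _)

lemma mem_hits {L : Finset (Set Pt)} (hL : ∀ l ∈ L, IsLine l) {m : Set Pt} (hm : IsLine m)
    {x : Pt} : x ∈ hits L m ↔ x ∈ m ∧ ∃ l ∈ L, l ≠ m ∧ x ∈ l := by
  simp only [hits, Finset.mem_image, Finset.mem_filter]
  constructor
  · rintro ⟨l, ⟨hl, hne, h⟩, rfl⟩
    exact ⟨(meet_mem h).2, l, hl, hne, (meet_mem h).1⟩
  · rintro ⟨hxm, l, hl, hne, hxl⟩
    exact ⟨l, ⟨hl, hne, ⟨x, hxl, hxm⟩⟩, meet_eq (hL l hl) hm hne hxl hxm⟩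

lemma hits_mono {S T : Finset (Set Pt)} (h : S ⊆ T) (m : Set Pt) : hits S m ⊆ hits T m :=
  Finset.image_subset_image (Finset.filter_subset_filter _ h)

/-- One greedy step: as long as most lines of `R` are unsaturated, some line of `L` has
many new hits. -/
lemma exists_greedy_step {L R S : Finset (Set Pt)} {M D : ℕ} (hL0 : L.Nonempty)
    (hR : ∀ m ∈ R, M ≤ (hits L m).card)
    (hS : 2 * (R.filter fun m => D < (hits S m).card).card < R.card) :
    ∃ l ∈ L, R.card * (M - D) + 2 * L.card * ∑ m ∈ R, min (hits S m).card (D + 1) ≤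
      2 * L.card * ∑ m ∈ R, min (hits (insert l S) m).card (D + 1) := by
  obtain ⟨U, hU⟩ : ∃ U, U = R.filter fun m => ¬ D < (hits S m).card := ⟨_, rfl⟩
  have hUmem : ∀ m ∈ U, m ∈ R ∧ (hits S m).card ≤ D := fun m hm => by
    rw [hU] at hm
    exact ⟨(Finset.mem_filter.1 hm).1, not_lt.1 (Finset.mem_filter.1 hm).2⟩
  have hsplit := Finset.card_filter_add_card_filter_not (s := R) (fun m => D < (hits S m).card)
  rw [← hU] at hsplit
  obtain ⟨rel, hrel⟩ : ∃ rel : Set Pt → Set Pt → Prop, rel = fun l m =>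
    (l ≠ m ∧ (l ∩ m).Nonempty) ∧ meet l m ∉ hits S m := ⟨_, rfl⟩
  have hnew : ∀ m ∈ U, M - D ≤ (L.filter fun l => rel l m).card := by
    intro m hm
    obtain ⟨hmR, hmD⟩ := hUmem m hm
    have h1 := hR m hmR
    have h2 := Finset.le_card_sdiff (hits S m) (hits L m)
    have h3 : hits L m \ hits S m ⊆ (L.filter fun l => rel l m).image fun l => meet l m := by
      intro x hx
      obtain ⟨hxL, hxS⟩ := Finset.mem_sdiff.1 hx
      obtain ⟨l, hl, rfl⟩ := Finset.mem_image.1 hxL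
      obtain ⟨hlL, hlm⟩ := Finset.mem_filter.1 hl
      refine Finset.mem_image.2 ⟨l, Finset.mem_filter.2 ⟨hlL, ?_⟩, rfl⟩
      rw [hrel]
      exact ⟨hlm, hxS⟩
    have h4 := (Finset.card_le_card h3).trans Finset.card_image_le
    omega
  have hdouble : ∑ l ∈ L, (U.filter fun m => rel l m).card =
      ∑ m ∈ U, (L.filter fun l => rel l m).card := by
    simp only [Finset.card_filter]
    exact Finset.sum_comm
  have hsum : ∑ _l ∈ L, R.card * (M - D) ≤
      ∑ l ∈ L, 2 * L.card * (U.filter fun m => rel l m).card := by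
    rw [Finset.sum_const, smul_eq_mul, ← Finset.mul_sum, hdouble]
    calc L.card * (R.card * (M - D)) ≤ L.card * (2 * U.card * (M - D)) := by
          gcongr
          omega
      _ = 2 * L.card * ∑ _m ∈ U, (M - D) := by
          rw [Finset.sum_const, smul_eq_mul]
          ring
      _ ≤ _ := by
          gcongr with m hm
          exact hnew m hm
  obtain ⟨l, hl, hle⟩ := Finset.exists_le_of_sum_le hL0 hsum
  refine ⟨l, hl, (Nat.add_le_add_right hle _).trans ?_⟩
  rw [← Nat.mul_add]
  gcongr
  have hUR : (U.filter fun m => rel l m) = R.filter fun m => m ∈ U ∧ rel l m := by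
    ext m
    simp only [Finset.mem_filter]
    exact ⟨fun h => ⟨(hUmem m h.1).1, h⟩, fun h => h.2⟩
  rw [hUR, Finset.card_filter, ← Finset.sum_add_distrib]
  refine Finset.sum_le_sum fun m hm => ?_
  have hmono := hits_mono (Finset.subset_insert l S) m
  have hc := Finset.card_le_card hmono
  split_ifs with h
  · have hlt : (hits S m).card < (hits (insert l S) m).card := by
      refine Finset.card_lt_card (Finset.ssubset_iff_subset_ne.2 ⟨hmono, fun heq => ?_⟩)
      have h2 := h.2
      rw [hrel] at h2
      refine h2.2 ?_
      rw [heq]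
      exact Finset.mem_image.2 ⟨l, Finset.mem_filter.2 ⟨Finset.mem_insert_self _ _, h2.1⟩, rfl⟩
    have := (hUmem m h.1).2
    omega
  · omega

/-- A small subset of `L` already has many hits on half of the lines of `R`. -/
lemma exists_saturating_subset {L R : Finset (Set Pt)} {M D k : ℕ} (hL0 : L.Nonempty)
    (hR0 : R.Nonempty) (hR : ∀ m ∈ R, M ≤ (hits L m).card)
    (hk : 2 * L.card * (D + 1) < k * (M - D)) :
    ∃ S ⊆ L, S.card ≤ k ∧ R.card ≤ 2 * (R.filter fun m => D < (hits S m).card).card := by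
  by_contra! hcon
  have key : ∀ j ≤ k, ∃ S ⊆ L, S.card ≤ j ∧
      j * (R.card * (M - D)) ≤ 2 * L.card * ∑ m ∈ R, min (hits S m).card (D + 1) := by
    intro j
    induction j with
    | zero => exact fun _ => ⟨∅, Finset.empty_subset _, by simp, by simp⟩
    | succ j ih =>
      intro hj
      obtain ⟨S, hSL, hSc, hS⟩ := ih (by omega)
      obtain ⟨l, hl, hle⟩ := exists_greedy_step hL0 hR (hcon S hSL (by omega))
      refine ⟨insert l S, Finset.insert_subset hl hSL, (Finset.card_insert_le _ _).trans (by omega),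
        ?_⟩
      rw [add_mul, one_mul]
      omega
  obtain ⟨S, -, -, hS⟩ := key k le_rfl
  have h1 : ∑ m ∈ R, min (hits S m).card (D + 1) ≤ R.card * (D + 1) := by
    rw [← smul_eq_mul]
    exact Finset.sum_le_card_nsmul _ _ _ fun m _ => min_le_right _ _
  have h2 := Nat.mul_le_mul_left (2 * L.card) h1
  have h3 := Finset.card_pos.2 hR0
  have h4 := Nat.mul_lt_mul_of_pos_left hk h3
  nlinarith

/-- Degree reduction: half of the lines of `R` lie in a surface of small degree. -/
lemma exists_low_degree {L R : Finset (Set Pt)} (hL : ∀ l ∈ L, IsLine l) (hRl : ∀ m ∈ R, IsLine m)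
    {M D k : ℕ} (hL0 : L.Nonempty) (hR0 : R.Nonempty) (hR : ∀ m ∈ R, M ≤ (hits L m).card)
    (hk : 2 * L.card * (D + 1) < k * (M - D)) (hkD : 6 * k < (D + 2) * (D + 3)) :
    ∃ g : Poly, g ≠ 0 ∧ g.totalDegree ≤ D ∧
      R.card ≤ 2 * (R.filter fun m => m ⊆ zeroSet g).card := by
  obtain ⟨S, hSL, hSk, hS⟩ := exists_saturating_subset hL0 hR0 hR hk
  have hSl : ∀ l ∈ S, IsLine l := fun l hl => hL l (hSL hl)
  obtain ⟨g, hg0, hgD, hg⟩ := exists_vanishing S hSl D (by omega)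
  refine ⟨g, hg0, hgD, hS.trans (Nat.mul_le_mul_left _ (Finset.card_le_card fun m hm => ?_))⟩
  obtain ⟨hmR, hmD⟩ := Finset.mem_filter.1 hm
  refine Finset.mem_filter.2 ⟨hmR, subset_zeroSet_of_card (hRl m hmR) (hits S m) (fun x hx => ?_)
    (by omega)⟩
  obtain ⟨hxm, l, hl, -, hxl⟩ := (mem_hits hSl (hRl m hmR)).1 hx
  exact ⟨hxm, hg l hl hxl⟩

/-- The irreducible factors of a polynomial. -/
lemma exists_irreducible_factors {g : Poly} (hg : g ≠ 0) :
    ∃ F : Finset Poly, (∀ f ∈ F, Irreducible f) ∧ ∑ f ∈ F, f.totalDegree ≤ g.totalDegree ∧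
      ∀ l, IsLine l → l ⊆ zeroSet g → ∃ f ∈ F, l ⊆ zeroSet f := by
  induction g using WfDvdMonoid.induction_on_irreducible with
  | zero => exact absurd rfl hg
  | unit u hu =>
    refine ⟨∅, by simp, by simp, fun l hl hlu => ?_⟩
    obtain ⟨x, hx⟩ := hl.infinite.nonempty
    exact absurd (hlu hx) (hu.map (eval x)).ne_zero
  | mul a i ha hi ih =>
    obtain ⟨F, hF, hdeg, hlines⟩ := ih ha
    refine ⟨insert i F, ?_, ?_, ?_⟩
    · intro f hf
      rcases Finset.mem_insert.1 hf with rfl | hf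
      · exact hi
      · exact hF f hf
    · rw [totalDegree_mul_of_isDomain hi.ne_zero ha]
      by_cases hiF : i ∈ F
      · rw [Finset.insert_eq_of_mem hiF]
        omega
      · rw [Finset.sum_insert hiF]
        omega
    · intro l hl hsub
      rcases (subset_zeroSet_mul_iff hl i a).1 hsub with h | h
      · exact ⟨i, Finset.mem_insert_self _ _, h⟩
      · obtain ⟨f, hf, hlf⟩ := hlines l hl h
        exact ⟨f, Finset.mem_insert_of_mem hf, hlf⟩

/-- Few points of a line off a collection of surfaces lie on these surfaces. -/
lemma card_transversal_points_le {L : Finset (Set Pt)} (hL : ∀ l ∈ L, IsLine l) (F : Finset Poly) :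
    ∃ A : Finset Pt, A.card ≤ L.card * ∑ f ∈ F, f.totalDegree ∧
      ∀ l ∈ L, ∀ f ∈ F, ¬ l ⊆ zeroSet f → ∀ x ∈ l, eval x f = 0 → x ∈ A := by
  have h : ∀ l ∈ L, ∀ f : Poly, ∃ A : Finset Pt, A.card ≤ f.totalDegree ∧
      (¬ l ⊆ zeroSet f → ∀ x ∈ l, eval x f = 0 → x ∈ A) := by
    intro l hl f
    by_cases hlf : l ⊆ zeroSet f
    · exact ⟨∅, by simp, fun h => absurd hlf h⟩
    · obtain ⟨hfin, hcard⟩ := finite_inter_zeroSet (hL l hl) hlf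
      rw [Set.ncard_eq_toFinset_card _ hfin] at hcard
      exact ⟨hfin.toFinset, hcard, fun _ x hx hxf => hfin.mem_toFinset.2 ⟨hx, hxf⟩⟩
  choose! A hA hAmem using h
  refine ⟨L.biUnion fun l => F.biUnion fun f => A l f, ?_, ?_⟩
  · exact Finset.card_biUnion_le_card_mul _ _ _ fun l hl =>
      Finset.card_biUnion_le.trans (Finset.sum_le_sum fun f _ => hA l hl f)
  · intro l hl f hf hlf x hx hxf
    exact Finset.mem_biUnion.2 ⟨l, hl, Finset.mem_biUnion.2 ⟨f, hf, hAmem l hl f hlf x hx hxf⟩⟩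

/-- Lines in a surface of low degree: discarding few lines, there are few hits on the others. -/
lemma exists_few_hits_of_low_degree {L R : Finset (Set Pt)} (hL : ∀ l ∈ L, IsLine l)
    (hR : ∀ m ∈ R, IsLine m) {s : ℕ} (hs : ∀ f : Poly, f ≠ 0 → f.totalDegree ≤ 2 →
      (L.filter fun l => l ⊆ zeroSet f).card ≤ s) {g : Poly} (hg : g ≠ 0)
    (hRg : ∀ m ∈ R, m ⊆ zeroSet g) :
    ∃ K ⊆ R, R.card ≤ K.card + 11 * g.totalDegree ^ 2 ∧
      (K.biUnion (hits L)).card ≤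
        L.card * g.totalDegree + K.card * (s + 13 * g.totalDegree) := by
  obtain ⟨F, hF, hdeg, hFl⟩ := exists_irreducible_factors hg
  choose! φ hφF hφ using fun m hm => hFl m (hR m hm) (hRg m hm)
  obtain ⟨A, hAcard, hA⟩ := card_transversal_points_le hL F
  obtain ⟨B, hB⟩ : ∃ B : Set Pt → Finset Pt,
    B = fun m => hits (L.filter fun l => l ⊆ zeroSet (φ m)) m := ⟨_, rfl⟩
  have hBmem : ∀ m ∈ R, ∀ x ∈ B m, IsCrossing (φ m) m x := by
    intro m hm x hx
    rw [hB] at hx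
    obtain ⟨hxm, l, hl, hlm, hxl⟩ :=
      (mem_hits (fun l hl => hL l (Finset.mem_filter.1 hl).1) (hR m hm)).1 hx
    obtain ⟨hlL, hlφ⟩ := Finset.mem_filter.1 hl
    exact ⟨hxm, l, hL l hlL, hlm, hxl, hlφ⟩
  obtain ⟨bad, hbad⟩ : ∃ bad : Set Pt → Prop,
    bad = fun m => 3 ≤ (φ m).totalDegree ∧ 13 * (φ m).totalDegree < (B m).card := ⟨_, rfl⟩
  have hdegle : ∀ f ∈ F, f.totalDegree ≤ g.totalDegree := fun f hf =>
    (Finset.single_le_sum (f := fun f : Poly => f.totalDegree) (fun _ _ => Nat.zero_le _) hf).trans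
      hdeg
  refine ⟨R.filter fun m => ¬ bad m, Finset.filter_subset _ _, ?_, ?_⟩
  · have hsplit := Finset.card_filter_add_card_filter_not (s := R) bad
    have hle : (R.filter bad).card ≤ 11 * g.totalDegree ^ 2 := by
      have h1 : R.filter bad ⊆ F.biUnion fun f => R.filter fun m => bad m ∧ φ m = f := by
        intro m hm
        obtain ⟨hmR, hmb⟩ := Finset.mem_filter.1 hm
        exact Finset.mem_biUnion.2 ⟨φ m, hφF m hmR, Finset.mem_filter.2 ⟨hmR, hmb, rfl⟩⟩
      have h2 : ∀ f ∈ F, (R.filter fun m => bad m ∧ φ m = f).card ≤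
          11 * f.totalDegree * g.totalDegree := by
        intro f hf
        rcases (R.filter fun m => bad m ∧ φ m = f).eq_empty_or_nonempty with he | ⟨m₀, hm₀⟩
        · simp [he]
        · have h3 : 3 ≤ f.totalDegree := by
            obtain ⟨-, hb, rfl⟩ := Finset.mem_filter.1 hm₀
            rw [hbad] at hb
            exact hb.1
          refine (card_rich_lines_le (hF f hf) h3 (R.filter fun m => bad m ∧ φ m = f)
            (fun m hm => hR m (Finset.mem_filter.1 hm).1) (fun m hm => ?_)
            (fun m hm => ?_)).trans ?_
          · obtain ⟨hmR, -, rfl⟩ := Finset.mem_filter.1 hm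
            exact hφ m hmR
          · obtain ⟨hmR, hb, rfl⟩ := Finset.mem_filter.1 hm
            rw [hbad] at hb
            exact ⟨B m, hb.2, hBmem m hmR⟩
          · have := hdegle f hf
            nlinarith [Nat.mul_le_mul_left f.totalDegree this]
      refine (Finset.card_le_card h1).trans (Finset.card_biUnion_le.trans
        ((Finset.sum_le_sum h2).trans ?_))
      rw [← Finset.sum_mul, ← Finset.mul_sum]
      nlinarith [Nat.mul_le_mul_right g.totalDegree hdeg]
    omega
  · obtain ⟨K, hK⟩ : ∃ K, K = R.filter fun m => ¬ bad m := ⟨_, rfl⟩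
    rw [← hK]
    have hKmem : ∀ m ∈ K, m ∈ R ∧ ¬ bad m := fun m hm => by
      rw [hK] at hm
      exact Finset.mem_filter.1 hm
    have hsub : K.biUnion (hits L) ⊆ A ∪ K.biUnion B := by
      intro x hx
      obtain ⟨m, hm, hxm⟩ := Finset.mem_biUnion.1 hx
      have hmR := (hKmem m hm).1
      obtain ⟨hxm, l, hl, hlm, hxl⟩ := (mem_hits hL (hR m hmR)).1 hxm
      rw [Finset.mem_union]
      by_cases hlφ : l ⊆ zeroSet (φ m)
      · refine Or.inr (Finset.mem_biUnion.2 ⟨m, hm, ?_⟩)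
        rw [hB]
        exact (mem_hits (fun l hl => hL l (Finset.mem_filter.1 hl).1) (hR m hmR)).2
          ⟨hxm, l, Finset.mem_filter.2 ⟨hl, hlφ⟩, hlm, hxl⟩
      · exact Or.inl (hA l hl (φ m) (hφF m hmR) hlφ x hxl (hφ m hmR hxm))
    refine (Finset.card_le_card hsub).trans ((Finset.card_union_le _ _).trans (add_le_add ?_ ?_))
    · exact hAcard.trans (Nat.mul_le_mul_left _ hdeg)
    · refine Finset.card_biUnion_le_card_mul _ _ _ fun m hm => ?_
      obtain ⟨hmR, hmb⟩ := hKmem m hm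
      rcases le_or_gt (φ m).totalDegree 2 with h2 | h2
      · have h3 := hs (φ m) (hF _ (hφF m hmR)).ne_zero h2
        have h4 := card_hits_le (L.filter fun l => l ⊆ zeroSet (φ m)) m
        simp only [hB]
        omega
      · have h3 : ¬ 13 * (φ m).totalDegree < (B m).card := fun h => hmb (by
          rw [hbad]
          exact ⟨h2, h⟩)
        have h4 := hdegle _ (hφF m hmR)
        omega

/-- A positive proportion of the lines receives few hits in total. -/
lemma exists_few_hits {L R : Finset (Set Pt)} (hL : ∀ l ∈ L, IsLine l) (hR : ∀ m ∈ R, IsLine m)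
    (hRL : R.card ≤ L.card) {s : ℕ} (hs : ∀ f : Poly, f ≠ 0 → f.totalDegree ≤ 2 →
      (L.filter fun l => l ⊆ zeroSet f).card ≤ s) :
    ∃ K ⊆ R, R.card ≤ 8 * K.card ∧ ((K.biUnion (hits L)).card : ℝ) ≤
      230 * (L.card * √(R.card : ℝ) + s * R.card) := by
  have hsq : √(R.card : ℝ) * √(R.card : ℝ) = R.card := Real.mul_self_sqrt (Nat.cast_nonneg _)
  obtain ⟨q, hq⟩ : ∃ q, q = √(R.card : ℝ) := ⟨_, rfl⟩
  have hq0 : 0 ≤ q := hq ▸ Real.sqrt_nonneg _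
  rw [← hq] at hsq ⊢
  have hnn : (0 : ℝ) ≤ L.card := Nat.cast_nonneg _
  have hsn : (0 : ℝ) ≤ s * R.card := by positivity
  have hRL' : (R.card : ℝ) ≤ L.card := by exact_mod_cast hRL
  rcases lt_or_ge R.card 88 with hsmall | hbig
  · refine ⟨R, subset_rfl, by omega, ?_⟩
    have h1 : (R.biUnion (hits L)).card ≤ R.card * L.card :=
      Finset.card_biUnion_le_card_mul _ _ _ fun m _ => card_hits_le L m
    have h2 : ((R.biUnion (hits L)).card : ℝ) ≤ R.card * L.card := by exact_mod_cast h1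
    have h3 : (R.card : ℝ) < 88 := by exact_mod_cast hsmall
    have h4 : q ≤ 10 := by nlinarith
    nlinarith [mul_nonneg hnn hq0, mul_le_mul_of_nonneg_left h4 (mul_nonneg hnn hq0)]
  obtain ⟨D, hD⟩ : ∃ D, D = Nat.sqrt (R.card / 88) := ⟨_, rfl⟩
  have hD1 : 88 * D ^ 2 ≤ R.card := by
    have h1 := Nat.sqrt_le' (R.card / 88)
    rw [← hD] at h1
    have h2 := Nat.div_mul_le_self R.card 88
    omega
  have hD2 : R.card < 88 * (D + 1) ^ 2 := by
    have h1 := Nat.lt_succ_sqrt' (R.card / 88)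
    rw [← hD, Nat.succ_eq_add_one] at h1
    omega
  have hDpos : 1 ≤ D := by
    rw [hD, Nat.le_sqrt']
    omega
  have hDq : (D : ℝ) ≤ q := by
    have : 88 * (D : ℝ) ^ 2 ≤ q * q := by rw [hsq]; exact_mod_cast hD1
    nlinarith
  have hD1' : (1 : ℝ) ≤ D := by exact_mod_cast hDpos
  have hqD : q ≤ 19 * D := by
    have h1 : q * q < 88 * ((D : ℝ) + 1) ^ 2 := by rw [hsq]; exact_mod_cast hD2
    nlinarith
  obtain ⟨M, hM⟩ : ∃ M, M = D + (12 * L.card / D + 1) := ⟨_, rfl⟩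
  have hLpos : 0 < L.card := by omega
  by_cases hpoor : R.card ≤ 2 * (R.filter fun m => ¬ M ≤ (hits L m).card).card
  · refine ⟨R.filter fun m => ¬ M ≤ (hits L m).card, Finset.filter_subset _ _, by omega, ?_⟩
    have h1 : ((R.filter fun m => ¬ M ≤ (hits L m).card).biUnion (hits L)).card ≤ R.card * M :=
      (Finset.card_biUnion_le_card_mul _ _ M fun m hm =>
        (not_le.1 (Finset.mem_filter.1 hm).2).le).trans
          (Nat.mul_le_mul_right _ (Finset.card_filter_le _ _))
    have h2 : (((R.filter fun m => ¬ M ≤ (hits L m).card).biUnion (hits L)).card : ℝ) ≤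
        R.card * M := by exact_mod_cast h1
    refine h2.trans ?_
    have h3 : (M : ℝ) ≤ D + (12 * L.card / D + 1) := by
      rw [hM]
      push_cast
      gcongr
      exact_mod_cast Nat.cast_div_le (α := ℝ)
    have h4 : q * (12 * L.card / D) ≤ 228 * L.card := by
      rw [mul_div_assoc', div_le_iff₀ (by linarith)]
      nlinarith
    have h5 : (R.card : ℝ) * M ≤ R.card * (2 * q) + q * (228 * L.card) := by
      calc (R.card : ℝ) * M ≤ R.card * (D + (12 * L.card / D + 1)) := by gcongr
        _ = R.card * (D + 1) + q * (q * (12 * L.card / D)) := by rw [← hsq]; ring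
        _ ≤ _ := by
          gcongr
          linarith
    nlinarith [mul_le_mul_of_nonneg_right hRL' hq0]
  · have hsplit := Finset.card_filter_add_card_filter_not (s := R)
      (fun m => M ≤ (hits L m).card)
    obtain ⟨R₁, hR₁⟩ : ∃ R₁, R₁ = R.filter fun m => M ≤ (hits L m).card := ⟨_, rfl⟩
    rw [← hR₁] at hsplit
    have hmem₁ : ∀ m ∈ R₁, m ∈ R ∧ M ≤ (hits L m).card := fun m hm => by
      rw [hR₁] at hm
      exact Finset.mem_filter.1 hm
    have hR₁pos : 0 < R₁.card := by omega
    obtain ⟨k, hk⟩ : ∃ k, k = (D * D + 5 * D + 5) / 6 := ⟨_, rfl⟩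
    have hk1 : D * (D + 1) ≤ 6 * k := by
      have : D * (D + 1) = D * D + D := by ring
      omega
    have hk2 : 6 * k < (D + 2) * (D + 3) := by
      have : (D + 2) * (D + 3) = D * D + 5 * D + 6 := by ring
      omega
    have hk3 : 2 * L.card * (D + 1) < k * (M - D) := by
      have h1 : M - D = 12 * L.card / D + 1 := by rw [hM, Nat.add_sub_cancel_left]
      have h2 : 12 * L.card < D * (12 * L.card / D + 1) := Nat.lt_mul_div_succ _ hDpos
      rw [h1]
      have h3 := Nat.mul_le_mul_right (12 * L.card / D + 1) hk1
      have h4 := Nat.mul_lt_mul_of_pos_right h2 (Nat.succ_pos D)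
      nlinarith
    obtain ⟨g, hg0, hgD, hg⟩ := exists_low_degree hL (fun m hm => hR m (hmem₁ m hm).1)
      (Finset.card_pos.1 hLpos) (Finset.card_pos.1 hR₁pos)
      (fun m hm => (hmem₁ m hm).2) hk3 hk2
    obtain ⟨R₂, hR₂⟩ : ∃ R₂, R₂ = R₁.filter fun m => m ⊆ zeroSet g := ⟨_, rfl⟩
    rw [← hR₂] at hg
    have hmem₂ : ∀ m ∈ R₂, m ∈ R ∧ m ⊆ zeroSet g := fun m hm => by
      rw [hR₂] at hm
      exact ⟨(hmem₁ m (Finset.mem_filter.1 hm).1).1, (Finset.mem_filter.1 hm).2⟩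
    obtain ⟨K, hKR, hKcard, hK⟩ := exists_few_hits_of_low_degree hL
      (fun m hm => hR m (hmem₂ m hm).1) hs hg0 (fun m hm => (hmem₂ m hm).2)
    have hKR' : K ⊆ R := fun m hm => (hmem₂ m (hKR hm)).1
    refine ⟨K, hKR', ?_, ?_⟩
    · have h1 := Nat.pow_le_pow_left hgD 2
      omega
    · have h1 : K.card ≤ R.card := Finset.card_le_card hKR'
      have h2 : (K.biUnion (hits L)).card ≤ L.card * D + R.card * (s + 13 * D) := by
        refine hK.trans ?_
        gcongr
      have h3 : ((K.biUnion (hits L)).card : ℝ) ≤ L.card * D + R.card * (s + 13 * D) := by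
        exact_mod_cast h2
      have h4 : (R.card : ℝ) * D ≤ L.card * q := mul_le_mul hRL' hDq (by linarith) hnn
      have h5 : (L.card : ℝ) * D ≤ L.card * q := mul_le_mul_of_nonneg_left hDq hnn
      nlinarith [mul_nonneg hnn hq0]

/-- The total number of hits. -/
lemma card_biUnion_hits_le {L : Finset (Set Pt)} (hL : ∀ l ∈ L, IsLine l) {s : ℕ}
    (hs : ∀ f : Poly, f ≠ 0 → f.totalDegree ≤ 2 →
      (L.filter fun l => l ⊆ zeroSet f).card ≤ s) (R : Finset (Set Pt))
    (hR : ∀ m ∈ R, IsLine m) (hRL : R.card ≤ L.card) :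
    ((R.biUnion (hits L)).card : ℝ) ≤ 4000 * (L.card * √(R.card : ℝ) + s * R.card) := by
  induction R using Finset.strongInduction with
  | H R ih =>
    rcases R.eq_empty_or_nonempty with rfl | hne
    · simp
    have hpos := Finset.card_pos.2 hne
    obtain ⟨K, hKR, hKcard, hK⟩ := exists_few_hits hL hR hRL hs
    have hsd : R \ K ⊂ R := Finset.sdiff_ssubset hKR (Finset.card_pos.1 (by omega))
    have hcard := Finset.card_sdiff_add_card_eq_card hKR
    have h1 := ih (R \ K) hsd (fun m hm => hR m (hsd.1 hm)) ((Finset.card_le_card hsd.1).trans hRL)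
    have h2 : ((R.biUnion (hits L)).card : ℝ) ≤
        (K.biUnion (hits L)).card + ((R \ K).biUnion (hits L)).card := by
      have h := Finset.card_union_le (K.biUnion (hits L)) ((R \ K).biUnion (hits L))
      rw [← Finset.union_biUnion, Finset.union_sdiff_of_subset hKR] at h
      exact_mod_cast h
    have h3 : (((R \ K).card : ℕ) : ℝ) ≤ 7 / 8 * R.card := by
      have : 8 * (R \ K).card ≤ 7 * R.card := by omega
      have : (8 : ℝ) * ((R \ K).card : ℝ) ≤ 7 * R.card := by exact_mod_cast this
      linarith
    have h4 : √((R \ K).card : ℝ) ≤ 94 / 100 * √(R.card : ℝ) := by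
      refine Real.sqrt_le_iff.2 ⟨by positivity, ?_⟩
      rw [mul_pow, Real.sq_sqrt (Nat.cast_nonneg _)]
      have : (0 : ℝ) ≤ R.card := Nat.cast_nonneg _
      linarith
    have h5 := mul_le_mul_of_nonneg_left h4 (Nat.cast_nonneg (α := ℝ) L.card)
    have h6 := mul_le_mul_of_nonneg_left h3 (Nat.cast_nonneg (α := ℝ) s)
    have h7 : (0 : ℝ) ≤ L.card * √(R.card : ℝ) := by positivity
    have h8 : (0 : ℝ) ≤ s * R.card := by positivity
    linarith

end LineIncidence

/-- **Bipartite Guth–Katz intersection bound.** There is an absolute constant `C` such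
that for two finite sets `L, L'` of lines in `ℝ³` with `|L'| ≤ |L|` and at most `s ≤ |L|`
lines of `L` in any plane or in the zero set of any nonzero polynomial of degree at most
`2`, the set `P` of points where some line of `L` meets a distinct line of `L'` satisfies
`|P| ≤ C (|L|·√|L'| + s·|L'|)`. -/
theorem bipartite_guth_katz_intersection_bound :
    ∃ C : ℝ, 0 < C ∧
      ∀ (L L' : Finset (Set (Fin 3 → ℝ))) (s : ℕ),
        (∀ l ∈ L, IsLine l) → (∀ l' ∈ L', IsLine l') →
        L'.card ≤ L.card → s ≤ L.card →
        (∀ π : Set (Fin 3 → ℝ), IsPlane π → (L.filter (fun l => l ⊆ π)).card ≤ s) →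
        (∀ f : MvPolynomial (Fin 3) ℝ, f ≠ 0 → f.totalDegree ≤ 2 →
          (L.filter (fun l => l ⊆ {x | MvPolynomial.eval x f = 0})).card ≤ s) →
        (({x : Fin 3 → ℝ | ∃ l ∈ L, ∃ l' ∈ L', l ≠ l' ∧ x ∈ l ∧ x ∈ l'}).ncard : ℝ) ≤
          C * ((L.card : ℝ) * Real.sqrt (L'.card : ℝ) + (s : ℝ) * (L'.card : ℝ)) := by
  refine ⟨4000, by norm_num, fun L L' s hL hL' hcard _ _ hs => ?_⟩
  have hP : {x : Fin 3 → ℝ | ∃ l ∈ L, ∃ l' ∈ L', l ≠ l' ∧ x ∈ l ∧ x ∈ l'} =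
      (L'.biUnion (LineIncidence.hits L) : Finset (Fin 3 → ℝ)) := by
    ext x
    rw [Finset.mem_coe, Finset.mem_biUnion]
    constructor
    · rintro ⟨l, hl, m, hm, hne, hxl, hxm⟩
      exact ⟨m, hm, (LineIncidence.mem_hits hL (hL' m hm)).2 ⟨hxm, l, hl, hne, hxl⟩⟩
    · rintro ⟨m, hm, hx⟩
      obtain ⟨hxm, l, hl, hne, hxl⟩ := (LineIncidence.mem_hits hL (hL' m hm)).1 hx
      exact ⟨l, hl, m, hm, hne, hxl, hxm⟩
  rw [hP, Set.ncard_coe_finset]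
  exact LineIncidence.card_biUnion_hits_le hL hs L' hL' hcard
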